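/- arXiv:2106.13796 — 4 statements merged into one kernel-verified Lean document; each statement's English description precedes it below -/
import Mathlib

section
/- Let a, b, c be positive integers with gcd(a,b,c) = 1, with g_1 = gcd(b,c), g_2 = gcd(c,a), g_3 = gcd(a,b), A = a/(g_2 g_3), B = b/(g_3 g_1), C = c/(g_1 g_2), α' = (A+B+C)/2, β' = 2ABC, M' = ⌊((2α'β'−1)² − 4α'²)/(4β') + α'⌋ + 1, γ'_k = ⌊√(β'(k+α') + α'²) − α'⌋ and δ'_k = ⌊√(β'(k−α') + α'²) − α'⌋. Suppose k ≥ M', γ'_k ≠ δ'_k, and the equation Ax + By + Cz = γ'_k has exactly k nonnegative integer solutions. Then the set R_k(a,b,c) has exactly g_1 g_2 g_3 elements; that is, c_{=k}(a,b,c) = g_1 g_2 g_3. -/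
/-- `numSol a b c n` is the number of triples `(x, y, z)` of nonnegative integers
satisfying `a*x + b*y + c*z = n`. -/
noncomputable def numSol (a b c n : ℕ) : ℕ :=
  {p : ℕ × ℕ × ℕ | a * p.1 + b * p.2.1 + c * p.2.2 = n}.ncard

/-- The number of solutions of `A x + B y = n` when `(x₀, y₀)` are the reduced residues. -/
theorem ncard_two_variables {A B n x₀ y₀ : ℕ} {w : ℤ} (hAB : Nat.Coprime A B)
    (hx : x₀ < B) (hy : y₀ < A) (h : (A : ℤ) * x₀ + B * y₀ + A * B * w = n) :
    (({p : ℕ × ℕ | A * p.1 + B * p.2 = n}.ncard : ℕ) : ℤ) = w + 1 := by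
  have hA : (0 : ℤ) < A := by omega
  have hB : (0 : ℤ) < B := by omega
  have hx' : (x₀ : ℤ) < B := by omega
  have hy' : (y₀ : ℤ) < A := by omega
  have hw : -1 ≤ w := by
    by_contra! hlt
    have h2 : w ≤ -2 := by omega
    have h3 : (A : ℤ) * x₀ < A * B := mul_lt_mul_of_pos_left hx' hA
    have h4 : (B : ℤ) * y₀ < B * A := mul_lt_mul_of_pos_left hy' hB
    have h5 : (A : ℤ) * B * w ≤ A * B * (-2) := mul_le_mul_of_nonneg_left h2 (by positivity)
    have h6 : (0 : ℤ) ≤ n := by positivity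
    nlinarith
  obtain ⟨W, hW⟩ : ∃ W : ℕ, w = (W : ℤ) - 1 := ⟨(w + 1).toNat, by omega⟩
  have key : {p : ℕ × ℕ | A * p.1 + B * p.2 = n} =
      (fun i : ℕ => (x₀ + B * i, y₀ + A * (W - 1 - i))) '' (Finset.range W : Set ℕ) := by
    ext ⟨x, y⟩
    simp only [Set.mem_ofPred_eq, Set.mem_image, Finset.coe_range, Set.mem_Iio, Prod.mk.injEq]
    constructor
    · intro hxy
      have hxy' : (A : ℤ) * x + B * y = n := by exact_mod_cast hxy
      have d1 : (B : ℤ) ∣ (x : ℤ) - x₀ := by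
        have : (B : ℤ) ∣ A * ((x : ℤ) - x₀) := ⟨y₀ + A * w - y, by linear_combination hxy' - h⟩
        exact (Nat.isCoprime_iff_coprime.mpr hAB.symm).dvd_of_dvd_mul_left this
      have d2 : (A : ℤ) ∣ (y : ℤ) - y₀ := by
        have : (A : ℤ) ∣ B * ((y : ℤ) - y₀) := ⟨x₀ + B * w - x, by linear_combination hxy' - h⟩
        exact (Nat.isCoprime_iff_coprime.mpr hAB).dvd_of_dvd_mul_left this
      obtain ⟨i, hi⟩ := d1
      obtain ⟨j, hj⟩ := d2
      have hi0 : 0 ≤ i := by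
        by_contra! hneg
        have : (B : ℤ) * i ≤ B * (-1) := mul_le_mul_of_nonneg_left (by omega) hB.le
        omega
      have hj0 : 0 ≤ j := by
        by_contra! hneg
        have : (A : ℤ) * j ≤ A * (-1) := mul_le_mul_of_nonneg_left (by omega) hA.le
        omega
      have hij : i + j = w := by
        have : (A : ℤ) * B * (i + j) = A * B * w := by
          linear_combination hxy' - h - A * hi - B * hj
        exact mul_left_cancel₀ (by positivity) this
      lift i to ℕ using hi0
      lift j to ℕ using hj0
      refine ⟨i, by omega, ?_, ?_⟩
      · zify
        linarith
      · have : W - 1 - i = j := by omega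
        rw [this]
        zify
        linarith
    · rintro ⟨i, hi, rfl, rfl⟩
      have : ((W - 1 - i : ℕ) : ℤ) = w - i := by omega
      zify
      rw [this]
      linear_combination h
  rw [key, Set.InjOn.ncard_image, Set.ncard_coe_finset, Finset.card_range]
  · omega
  · intro i _ j _ hij
    simp only [Prod.mk.injEq, Nat.add_left_cancel_iff] at hij
    exact Nat.eq_of_mul_eq_mul_left (by omega) hij.1

theorem finite_solutions {a b c : ℕ} (ha : 0 < a) (hb : 0 < b) (hc : 0 < c) (n : ℕ) :
    {p : ℕ × ℕ × ℕ | a * p.1 + b * p.2.1 + c * p.2.2 = n}.Finite := by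
  refine (Set.finite_Iic ((n, n, n) : ℕ × ℕ × ℕ)).subset ?_
  rintro ⟨x, y, z⟩ h
  simp only [Set.mem_ofPred_eq] at h
  simp only [Set.mem_Iic, Prod.mk_le_mk]
  have h1 := Nat.le_mul_of_pos_left x ha
  have h2 := Nat.le_mul_of_pos_left y hb
  have h3 := Nat.le_mul_of_pos_left z hc
  exact ⟨by omega, by omega, by omega⟩

theorem numSol_eq_sum {a b c : ℕ} (ha : 0 < a) (hb : 0 < b) (hc : 0 < c) (n : ℕ) :
    numSol a b c n =
      ∑ z ∈ Finset.range (n / c + 1), {p : ℕ × ℕ | a * p.1 + b * p.2 = n - c * z}.ncard := by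
  classical
  have hfin := finite_solutions ha hb hc n
  rw [numSol, Set.ncard_eq_toFinset_card _ hfin,
    Finset.card_eq_sum_card_fiberwise (f := fun p : ℕ × ℕ × ℕ => p.2.2)
      (t := Finset.range (n / c + 1))]
  · refine Finset.sum_congr rfl fun z hz => ?_
    have hz' : c * z ≤ n := by
      rw [mul_comm, ← Nat.le_div_iff_mul_le hc]
      exact Nat.lt_succ_iff.mp (Finset.mem_range.mp hz)
    rw [← Set.ncard_coe_finset]
    symm
    refine Set.ncard_congr (fun p _ => (p.1, p.2, z)) ?_ ?_ ?_
    · rintro ⟨x, y⟩ h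
      simp only [Set.mem_ofPred_eq] at h
      simp
      omega
    · rintro ⟨x, y⟩ ⟨x', y'⟩ _ _ h
      simpa using h
    · rintro ⟨x, y, z'⟩ h
      simp at h
      obtain ⟨h, rfl⟩ := h
      exact ⟨(x, y), by simp; omega, rfl⟩
  · rintro ⟨x, y, z⟩ h
    simp at h
    simp only [Finset.coe_range, Set.mem_Iio, Nat.lt_succ_iff]
    rw [Nat.le_div_iff_mul_le hc, mul_comm]
    omega

/-- Partial sums of a periodic sequence in `[0, B - 1]` with mean `(B - 1) / 2` deviate
boundedly from their average. -/
theorem abs_sum_sub_mean_le {B : ℕ} (hB : 0 < B) {g : ℕ → ℝ} (hper : Function.Periodic g B)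
    (h0 : ∀ z, 0 ≤ g z) (h1 : ∀ z, g z ≤ B - 1)
    (hsum : ∑ z ∈ Finset.range B, g z = B * (B - 1) / 2) (n : ℕ) :
    |∑ z ∈ Finset.range n, g z - n * ((B - 1) / 2)| ≤ B * ((B - 1) / 2) := by
  set D : ℕ → ℝ := fun n => ∑ z ∈ Finset.range n, g z - n * (((B : ℝ) - 1) / 2) with hD
  have hB1 : (1 : ℝ) ≤ B := by exact_mod_cast hB
  have hDper : Function.Periodic D B := by
    intro n
    induction n with
    | zero => simp only [hD, zero_add, hsum]; simp; ring
    | succ n ih =>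
      have hg := hper n
      simp only [hD] at ih ⊢
      rw [show n + 1 + B = (n + B) + 1 by ring, Finset.sum_range_succ, Finset.sum_range_succ, hg]
      push_cast at ih ⊢
      linarith
  have hbound : ∀ n : ℕ, |D n| ≤ n * (((B : ℝ) - 1) / 2) := by
    intro n
    have l : 0 ≤ ∑ z ∈ Finset.range n, g z := Finset.sum_nonneg fun z _ => h0 z
    have u : ∑ z ∈ Finset.range n, g z ≤ n * ((B : ℝ) - 1) := by
      simpa using Finset.sum_le_card_nsmul (Finset.range n) g ((B : ℝ) - 1) fun z _ => h1 z
    simp only [hD]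
    rw [abs_le]
    constructor <;> linarith
  change |D n| ≤ _
  rw [← hDper.map_mod_nat n]
  refine (hbound _).trans (mul_le_mul_of_nonneg_right ?_ (by linarith))
  exact_mod_cast (Nat.mod_lt n hB).le

theorem sum_val_affine {B : ℕ} [NeZero B] {u v : ZMod B} (hv : IsUnit v) :
    ∑ z ∈ Finset.range B, (((u - v * (z : ZMod B)).val : ℕ) : ℝ) = B * (B - 1) / 2 := by
  have hbij : Function.Bijective fun z : ZMod B => u - v * z := by
    rw [← Finite.injective_iff_bijective]
    intro x y h
    exact hv.mul_left_cancel (by simpa using h)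
  have hrange : ∀ f : ZMod B → ℝ, ∑ z ∈ Finset.range B, f (z : ZMod B) = ∑ z : ZMod B, f z := by
    intro f
    refine Finset.sum_bij (fun z _ => (z : ZMod B)) (by simp) ?_ ?_ (by simp)
    · intro x hx y hy h
      have := (ZMod.natCast_eq_natCast_iff' x y B).mp h
      rwa [Nat.mod_eq_of_lt (Finset.mem_range.mp hx),
        Nat.mod_eq_of_lt (Finset.mem_range.mp hy)] at this
    · intro z _
      exact ⟨z.val, Finset.mem_range.mpr (ZMod.val_lt z), by simp⟩
  rw [hrange fun z => (((u - v * z).val : ℕ) : ℝ),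
    hbij.sum_comp fun z : ZMod B => ((z.val : ℕ) : ℝ), ← hrange fun z => ((z.val : ℕ) : ℝ)]
  have : ∀ n : ℕ, ∑ z ∈ Finset.range n, (z : ℝ) = n * (n - 1) / 2 := by
    intro n
    induction n with
    | zero => simp
    | succ n ih => rw [Finset.sum_range_succ, ih]; push_cast; ring
  rw [← this B]
  refine Finset.sum_congr rfl fun z hz => ?_
  rw [ZMod.val_natCast_of_lt (Finset.mem_range.mp hz)]

/-- The reduced solution of `A x ≡ n - C z` modulo `B`, as a function of `z`. -/
noncomputable def residue (A B C n z : ℕ) : ℕ :=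
  ((n : ZMod B) * (A : ZMod B)⁻¹ - (C : ZMod B) * (A : ZMod B)⁻¹ * (z : ZMod B)).val

theorem residue_lt {A B C n z : ℕ} (hB : 0 < B) : residue A B C n z < B :=
  have : NeZero B := ⟨hB.ne'⟩
  ZMod.val_lt _

theorem dvd_residue {A B C n z : ℕ} (hB : 0 < B) (hAB : Nat.Coprime A B) :
    (B : ℤ) ∣ (n : ℤ) - C * z - A * residue A B C n z := by
  have : NeZero B := ⟨hB.ne'⟩
  rw [← ZMod.intCast_zmod_eq_zero_iff_dvd]
  push_cast
  rw [residue, ZMod.natCast_zmod_val]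
  have := ZMod.coe_mul_inv_eq_one A hAB
  linear_combination ((C : ZMod B) * z - n) * this

theorem abs_sum_residue_sub_le {A B C : ℕ} (hB : 0 < B) (hAB : Nat.Coprime A B)
    (hCB : Nat.Coprime C B) (n m : ℕ) :
    |∑ z ∈ Finset.range m, (residue A B C n z : ℝ) - m * ((B - 1) / 2)| ≤ B * ((B - 1) / 2) := by
  have : NeZero B := ⟨hB.ne'⟩
  refine abs_sum_sub_mean_le hB ?_ (fun z => by positivity) ?_ ?_ m
  · intro z
    simp [residue]
  · intro z
    have : residue A B C n z + 1 ≤ B := residue_lt hB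
    have : (residue A B C n z : ℝ) + 1 ≤ B := by exact_mod_cast this
    linarith
  · refine sum_val_affine (IsUnit.mul ?_ ?_)
    · exact (ZMod.isUnit_iff_coprime C B).mpr hCB
    · have := ZMod.coe_mul_inv_eq_one A hAB
      exact IsUnit.of_mul_eq_one _ (by rwa [mul_comm] at this)

/-- The number of solutions differs from its quadratic main term by at most
`(A + B + C) / 2`. -/
theorem abs_numSol_sub_le {A B C : ℕ} (hA : 0 < A) (hB : 0 < B) (hC : 0 < C)
    (hAB : Nat.Coprime A B) (hBC : Nat.Coprime B C) (hCA : Nat.Coprime C A) (n : ℕ) :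
    |(numSol A B C n : ℝ) - n * (n + (A + B + C)) / (2 * A * B * C)| ≤
      ((A : ℝ) + B + C) / 2 := by
  have hA1 : (1 : ℝ) ≤ A := by exact_mod_cast hA
  have hB1 : (1 : ℝ) ≤ B := by exact_mod_cast hB
  have hC1 : (1 : ℝ) ≤ C := by exact_mod_cast hC
  set X : ℕ → ℕ := residue A B C n with hX
  set Y : ℕ → ℕ := residue B A C n with hY
  set m := n / C with hm
  have hN : (numSol A B C n : ℝ) = ∑ z ∈ Finset.range (m + 1),
      (((n : ℝ) - C * z - A * X z - B * Y z) / (A * B) + 1) := by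
    rw [numSol_eq_sum hA hB hC]
    push_cast
    refine Finset.sum_congr rfl fun z hz => ?_
    have hz' : C * z ≤ n := by
      rw [mul_comm, ← Nat.le_div_iff_mul_le hC]
      exact Nat.lt_succ_iff.mp (Finset.mem_range.mp hz)
    have d1 : (B : ℤ) ∣ (n : ℤ) - C * z - A * X z - B * Y z :=
      dvd_sub (dvd_residue hB hAB) (dvd_mul_right _ _)
    have d2 : (A : ℤ) ∣ (n : ℤ) - C * z - A * X z - B * Y z := by
      have := dvd_sub (dvd_residue (n := n) (z := z) (C := C) hA hAB.symm)
        (dvd_mul_right (A : ℤ) (X z))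
      rw [sub_right_comm] at this
      exact this
    obtain ⟨w, hw⟩ := (Nat.isCoprime_iff_coprime.mpr hAB).mul_dvd d2 d1
    have h := ncard_two_variables (n := n - C * z) (w := w) hAB (residue_lt hB : X z < B)
      (residue_lt hA : Y z < A) (by rw [Nat.cast_sub hz']; push_cast; linear_combination -hw)
    have h' : (({p : ℕ × ℕ | A * p.1 + B * p.2 = n - C * z}.ncard : ℕ) : ℝ) = w + 1 := by
      exact_mod_cast h
    have hw' : (n : ℝ) - C * z - A * X z - B * Y z = A * B * w := by exact_mod_cast hw
    rw [h', hw', mul_div_cancel_left₀ _ (by positivity)]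
  have hDX := abs_sum_residue_sub_le (A := A) (C := C) hB hAB hBC.symm n (m + 1)
  have hDY := abs_sum_residue_sub_le (A := B) (C := C) hA hAB.symm hCA n (m + 1)
  rw [← hX] at hDX
  rw [← hY] at hDY
  set SX := ∑ z ∈ Finset.range (m + 1), (X z : ℝ) with hSX
  set SY := ∑ z ∈ Finset.range (m + 1), (Y z : ℝ) with hSY
  have hZ : ∑ z ∈ Finset.range (m + 1), (z : ℝ) = m * (m + 1) / 2 := by
    clear_value m
    clear * -
    induction m with
    | zero => simp
    | succ m ih => rw [Finset.sum_range_succ, ih]; push_cast; ring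
  have hN' : (numSol A B C n : ℝ) =
      ((m + 1) * n - C * (m * (m + 1) / 2) - A * SX - B * SY) / (A * B) + (m + 1) := by
    rw [hN, Finset.sum_add_distrib, ← Finset.sum_div]
    simp only [Finset.sum_sub_distrib, ← Finset.mul_sum, hZ, ← hSX, ← hSY]
    simp
  obtain ⟨s, hs, hsC⟩ : ∃ s : ℝ, (n : ℝ) = C * m + s ∧ 0 ≤ s ∧ s ≤ C := by
    refine ⟨(n % C : ℕ), ?_, by positivity, by exact_mod_cast (Nat.mod_lt n hC).le⟩
    exact_mod_cast (Nat.div_add_mod n C).symm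
  obtain ⟨hs0, hsC⟩ := hsC
  push_cast at hDX hDY
  set dX : ℝ := (SX - (m + 1) * ((B - 1) / 2)) / B with hdX
  set dY : ℝ := (SY - (m + 1) * ((A - 1) / 2)) / A with hdY
  have hdX' : |dX| ≤ ((B : ℝ) - 1) / 2 := by
    rw [hdX, abs_div, abs_of_pos (by positivity : (0 : ℝ) < B), div_le_iff₀ (by positivity)]
    linarith
  have hdY' : |dY| ≤ ((A : ℝ) - 1) / 2 := by
    rw [hdY, abs_div, abs_of_pos (by positivity : (0 : ℝ) < A), div_le_iff₀ (by positivity)]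
    linarith
  have hmain : (numSol A B C n : ℝ) - n * (n + (A + B + C)) / (2 * A * B * C) =
      (C - s) * (s + A + B) / (2 * A * B * C) - dX - dY := by
    rw [hN', hdX, hdY, hs]
    field_simp
    ring
  have hE0 : 0 ≤ (C - s) * (s + A + B) / (2 * A * B * C) := by
    have : 0 ≤ (C : ℝ) - s := by linarith
    positivity
  have hE1 : (C - s) * (s + A + B) / (2 * A * B * C) ≤ ((C : ℝ) + 2) / 2 := by
    rw [div_le_iff₀ (by positivity)]
    have e1 : (C - s) * (s + A + B) ≤ C * (C + A + B) :=
      mul_le_mul (by linarith) (by linarith) (by positivity) (by positivity)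
    have e2 : (C : ℝ) + A + B ≤ (C + 2) * (A * B) := by
      have e3 : 0 ≤ ((A : ℝ) - 1) * (B - 1) := mul_nonneg (by linarith) (by linarith)
      have e4 : 1 ≤ (A : ℝ) * B := by nlinarith
      nlinarith
    nlinarith
  rw [hmain]
  rw [abs_le] at hdX' hdY' ⊢
  constructor <;> linarith [hdX'.1, hdX'.2, hdY'.1, hdY'.2]

theorem numSol_shift {A B C g₁ g₂ g₃ i j l n : ℕ} (h₁ : Nat.Coprime g₁ (g₂ * g₃ * A))
    (h₂ : Nat.Coprime g₂ (g₃ * g₁ * B)) (h₃ : Nat.Coprime g₃ (g₁ * g₂ * C))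
    (hi : i < g₁) (hj : j < g₂) (hl : l < g₃) :
    numSol (g₂ * g₃ * A) (g₃ * g₁ * B) (g₁ * g₂ * C)
      (g₂ * g₃ * A * i + g₃ * g₁ * B * j + g₁ * g₂ * C * l + g₁ * g₂ * g₃ * n) =
      numSol A B C n := by
  have hg : 0 < g₁ * g₂ * g₃ := Nat.mul_pos (Nat.mul_pos (by omega) (by omega)) (by omega)
  have lift_residue : ∀ {g a i x : ℕ} {s : ℤ}, Nat.Coprime g a → i < g →
      (a : ℤ) * x = a * i + g * s → ∃ x', x = i + g * x' := by
    intro g a i x s hc hi h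
    have hd : (g : ℤ) ∣ (x : ℤ) - i :=
      (Nat.isCoprime_iff_coprime.mpr hc).dvd_of_dvd_mul_left ⟨s, by linear_combination h⟩
    have hmod : i ≡ x [MOD g] := (Nat.modEq_iff_dvd).mpr hd
    refine ⟨x / g, ?_⟩
    have : x % g = i := by rw [← hmod, Nat.mod_eq_of_lt hi]
    rw [← this, Nat.mod_add_div]
  symm
  refine Set.ncard_congr (fun p _ => (i + g₁ * p.1, j + g₂ * p.2.1, l + g₃ * p.2.2)) ?_ ?_ ?_
  · rintro ⟨x, y, z⟩ h
    simp only [Set.mem_ofPred_eq] at h ⊢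
    rw [← h]
    ring
  · rintro ⟨x, y, z⟩ ⟨x', y', z'⟩ _ _ h
    simp only [Prod.mk.injEq, Nat.add_left_cancel_iff] at h ⊢
    exact ⟨Nat.eq_of_mul_eq_mul_left (by omega) h.1, Nat.eq_of_mul_eq_mul_left (by omega) h.2.1,
      Nat.eq_of_mul_eq_mul_left (by omega) h.2.2⟩
  · rintro ⟨x, y, z⟩ h
    simp only [Set.mem_ofPred_eq] at h
    have hZ : ((g₂ * g₃ * A : ℕ) : ℤ) * x + (g₃ * g₁ * B : ℕ) * y + (g₁ * g₂ * C : ℕ) * z =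
        (g₂ * g₃ * A : ℕ) * i + (g₃ * g₁ * B : ℕ) * j + (g₁ * g₂ * C : ℕ) * l +
          g₁ * g₂ * g₃ * n := by exact_mod_cast h
    obtain ⟨x', rfl⟩ := lift_residue (x := x)
      (s := g₃ * B * j + g₂ * C * l + g₂ * g₃ * n - g₃ * B * y - g₂ * C * z) h₁ hi
      (by push_cast at hZ ⊢; linear_combination hZ)
    obtain ⟨y', rfl⟩ := lift_residue (x := y)
      (s := g₃ * A * i + g₁ * C * l + g₁ * g₃ * n - g₃ * A * (i + g₁ * x' : ℕ) - g₁ * C * z)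
      h₂ hj (by push_cast at hZ ⊢; linear_combination hZ)
    obtain ⟨z', rfl⟩ := lift_residue (x := z)
      (s := g₂ * A * i + g₁ * B * j + g₁ * g₂ * n - g₂ * A * (i + g₁ * x' : ℕ)
        - g₁ * B * (j + g₂ * y' : ℕ)) h₃ hl (by push_cast at hZ ⊢; linear_combination hZ)
    refine ⟨(x', y', z'), ?_, rfl⟩
    simp only [Set.mem_ofPred_eq]
    refine Nat.eq_of_mul_eq_mul_left hg ?_
    nlinarith

/-- If `n` is the only number with exactly `k > 0` representations in terms of `A, B, C`, then
exactly `g₁ g₂ g₃` numbers have `k` representations in terms of the scaled coefficients. -/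
theorem ncard_numSol_eq {A B C g₁ g₂ g₃ k n : ℕ} (h₁ : Nat.Coprime g₁ (g₂ * g₃ * A))
    (h₂ : Nat.Coprime g₂ (g₃ * g₁ * B)) (h₃ : Nat.Coprime g₃ (g₁ * g₂ * C))
    (hg₁ : 0 < g₁) (hg₂ : 0 < g₂) (hg₃ : 0 < g₃) (hk : 0 < k)
    (hn : ∀ m, numSol A B C m = k ↔ m = n) :
    {t : ℕ | numSol (g₂ * g₃ * A) (g₃ * g₁ * B) (g₁ * g₂ * C) t = k}.ncard = g₁ * g₂ * g₃ := by
  have key : {t : ℕ | numSol (g₂ * g₃ * A) (g₃ * g₁ * B) (g₁ * g₂ * C) t = k} =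
      (fun p : ℕ × ℕ × ℕ => g₂ * g₃ * A * p.1 + g₃ * g₁ * B * p.2.1 + g₁ * g₂ * C * p.2.2 +
        g₁ * g₂ * g₃ * n) ''
      ((Finset.range g₁ ×ˢ Finset.range g₂ ×ˢ Finset.range g₃ : Finset (ℕ × ℕ × ℕ)) :
        Set (ℕ × ℕ × ℕ)) := by
    ext t
    simp only [Set.mem_ofPred_eq, Set.mem_image, Finset.mem_coe, Finset.mem_product,
      Finset.mem_range]
    constructor
    · intro ht
      obtain ⟨⟨x, y, z⟩, hp⟩ := Set.nonempty_of_ncard_ne_zero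
        (show {p : ℕ × ℕ × ℕ | g₂ * g₃ * A * p.1 + g₃ * g₁ * B * p.2.1 + g₁ * g₂ * C * p.2.2 =
          t}.ncard ≠ 0 by rw [numSol] at ht; omega)
      simp only [Set.mem_ofPred_eq] at hp
      have hdecomp : t = g₂ * g₃ * A * (x % g₁) + g₃ * g₁ * B * (y % g₂) +
          g₁ * g₂ * C * (z % g₃) +
          g₁ * g₂ * g₃ * (A * (x / g₁) + B * (y / g₂) + C * (z / g₃)) := by
        rw [← hp]
        conv_lhs => rw [← Nat.mod_add_div x g₁, ← Nat.mod_add_div y g₂, ← Nat.mod_add_div z g₃]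
        ring
      refine ⟨(x % g₁, y % g₂, z % g₃),
        ⟨Nat.mod_lt _ hg₁, Nat.mod_lt _ hg₂, Nat.mod_lt _ hg₃⟩, ?_⟩
      rw [hdecomp, numSol_shift h₁ h₂ h₃ (Nat.mod_lt _ hg₁) (Nat.mod_lt _ hg₂) (Nat.mod_lt _ hg₃),
        hn] at ht
      rw [hdecomp, ht]
    · rintro ⟨⟨i, j, l⟩, ⟨hi, hj, hl⟩, rfl⟩
      rw [numSol_shift h₁ h₂ h₃ hi hj hl, hn]
  rw [key, Set.InjOn.ncard_image, Set.ncard_coe_finset]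
  · simp [mul_assoc]
  · rintro ⟨i, j, l⟩ hp ⟨i', j', l'⟩ hp' h
    simp only [Finset.mem_coe, Finset.mem_product, Finset.mem_range] at hp hp' h
    have hZ : ((g₂ * g₃ * A : ℕ) : ℤ) * i + (g₃ * g₁ * B : ℕ) * j + (g₁ * g₂ * C : ℕ) * l =
        (g₂ * g₃ * A : ℕ) * i' + (g₃ * g₁ * B : ℕ) * j' + (g₁ * g₂ * C : ℕ) * l' := by
      exact_mod_cast Nat.add_right_cancel h
    have eq_of_dvd : ∀ {g a i i' : ℕ} (s : ℤ), Nat.Coprime g a → i < g → i' < g →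
        (a : ℤ) * i = a * i' + g * s → i = i' := by
      intro g a i i' s hc hi hi' h
      have hd : (g : ℤ) ∣ (i : ℤ) - i' :=
        (Nat.isCoprime_iff_coprime.mpr hc).dvd_of_dvd_mul_left ⟨s, by linear_combination h⟩
      exact (((Nat.modEq_iff_dvd).mpr hd).eq_of_lt_of_lt hi' hi).symm
    simp only [Prod.mk.injEq]
    push_cast at hZ
    refine ⟨eq_of_dvd (g₃ * B * j' + g₂ * C * l' - g₃ * B * j - g₂ * C * l) h₁ hp.1 hp'.1 ?_,
      eq_of_dvd (g₃ * A * i' + g₁ * C * l' - g₃ * A * i - g₁ * C * l) h₂ hp.2.1 hp'.2.1 ?_,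
      eq_of_dvd (g₂ * A * i' + g₁ * B * j' - g₂ * A * i - g₁ * B * j) h₃ hp.2.2 hp'.2.2 ?_⟩ <;>
    · push_cast
      linear_combination hZ

theorem mul_gcd_div {a b c : ℕ} (h : Nat.gcd (Nat.gcd a b) c = 1) :
    Nat.gcd c a * Nat.gcd a b * (a / (Nat.gcd c a * Nat.gcd a b)) = a := by
  refine Nat.mul_div_cancel' (Nat.Coprime.mul_dvd_of_dvd_of_dvd ?_ (Nat.gcd_dvd_right _ _)
    (Nat.gcd_dvd_left _ _))
  rw [Nat.coprime_comm]
  exact Nat.Coprime.coprime_dvd_right (Nat.gcd_dvd_left c a) h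

theorem coprime_of_gcd_eq {g u v A B : ℕ} (hg : 0 < g)
    (h : g = Nat.gcd (u * g * A) (g * v * B)) : Nat.Coprime A B := by
  rw [show u * g * A = g * (u * A) by ring, mul_assoc, Nat.gcd_mul_left] at h
  have : Nat.Coprime (u * A) (v * B) :=
    Nat.eq_of_mul_eq_mul_left hg (by rw [mul_one]; exact h.symm)
  exact Nat.Coprime.coprime_mul_left (Nat.Coprime.coprime_mul_left_right this)

/-- For large `k`, a window of values whose main term is within `α` of `k` has length
less than one. -/
theorem window_unique {α β k m n : ℝ} (hα : 0 < α) (hβ : 0 < β)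
    (hk : ((2 * α * β - 1) ^ 2 - 4 * α ^ 2) / (4 * β) + α < k) (hm : 0 ≤ m) (hn : 0 ≤ n)
    (h₁ : |k - m * (m + 2 * α) / β| ≤ α) (h₂ : |k - n * (n + 2 * α) / β| ≤ α) : m < n + 1 := by
  by_contra! hlt
  rw [abs_le] at h₁ h₂
  have u : m * (m + 2 * α) ≤ β * (k + α) := by
    rw [mul_comm β, ← div_le_iff₀ hβ]; linarith
  have l : β * (k - α) ≤ n * (n + 2 * α) := by
    rw [mul_comm β, ← le_div_iff₀ hβ]; linarith
  have hk' : (2 * α * β - 1) ^ 2 - 4 * α ^ 2 < 4 * (β * (k - α)) := by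
    have : ((2 * α * β - 1) ^ 2 - 4 * α ^ 2) / (4 * β) < k - α := by linarith
    rw [div_lt_iff₀ (by positivity)] at this
    linarith
  have h3 : (2 * α * β - 1) ^ 2 < (2 * (n + α)) ^ 2 := by nlinarith
  have h4 : 2 * α * β - 1 < 2 * (n + α) := lt_of_pow_lt_pow_left₀ 2 (by positivity) h3
  have h5 : (n + 1) * (n + 1 + 2 * α) ≤ m * (m + 2 * α) :=
    mul_le_mul hlt (by linarith) (by positivity) hm
  nlinarith

theorem stmt_10 (a b c : ℕ)
    (ha : 0 < a) (hb : 0 < b) (hc : 0 < c)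
    (habc : Nat.gcd (Nat.gcd a b) c = 1)
    (g1 g2 g3 : ℕ) (hg1 : g1 = Nat.gcd b c) (hg2 : g2 = Nat.gcd c a)
    (hg3 : g3 = Nat.gcd a b)
    (A B C : ℕ) (hA : A = a / (g2 * g3)) (hB : B = b / (g3 * g1))
    (hC : C = c / (g1 * g2))
    (α β : ℝ) (hα : α = ((A : ℝ) + B + C) / 2) (hβ : β = 2 * A * B * C)
    (M : ℤ) (hM : M = ⌊((2 * α * β - 1) ^ 2 - 4 * α ^ 2) / (4 * β) + α⌋ + 1)
    (k : ℕ)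
    (γ δ : ℤ)
    (hγ : γ = ⌊Real.sqrt (β * ((k : ℝ) + α) + α ^ 2) - α⌋)
    (hδ : δ = ⌊Real.sqrt (β * ((k : ℝ) - α) + α ^ 2) - α⌋)
    (hk : M ≤ (k : ℤ)) (hγδ : γ ≠ δ)
    (hsol : {p : ℕ × ℕ × ℕ |
      (A : ℤ) * p.1 + (B : ℤ) * p.2.1 + (C : ℤ) * p.2.2 = γ}.ncard = k) :
    {t : ℕ | numSol a b c t = k}.ncard = g1 * g2 * g3 := by
  have hg1p : 0 < g1 := hg1 ▸ Nat.gcd_pos_of_pos_left _ hb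
  have hg2p : 0 < g2 := hg2 ▸ Nat.gcd_pos_of_pos_left _ hc
  have hg3p : 0 < g3 := hg3 ▸ Nat.gcd_pos_of_pos_left _ ha
  have hbca : Nat.gcd (Nat.gcd b c) a = 1 := by rw [Nat.gcd_comm, ← Nat.gcd_assoc, habc]
  have hcab : Nat.gcd (Nat.gcd c a) b = 1 := by rw [Nat.gcd_assoc, Nat.gcd_comm, habc]
  have ea : g2 * g3 * A = a := by rw [hA, hg2, hg3]; exact mul_gcd_div habc
  have eb : g3 * g1 * B = b := by rw [hB, hg3, hg1]; exact mul_gcd_div hbca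
  have ec : g1 * g2 * C = c := by rw [hC, hg1, hg2]; exact mul_gcd_div hcab
  have hAp : 0 < A := Nat.pos_of_ne_zero (by rintro rfl; omega)
  have hBp : 0 < B := Nat.pos_of_ne_zero (by rintro rfl; omega)
  have hCp : 0 < C := Nat.pos_of_ne_zero (by rintro rfl; omega)
  have hAB : Nat.Coprime A B :=
    coprime_of_gcd_eq (g := g3) (u := g2) (v := g1) hg3p (by rw [ea, eb, hg3])
  have hBC : Nat.Coprime B C :=
    coprime_of_gcd_eq (g := g1) (u := g3) (v := g2) hg1p (by rw [eb, ec, hg1])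
  have hCA : Nat.Coprime C A :=
    coprime_of_gcd_eq (g := g2) (u := g1) (v := g3) hg2p (by rw [ec, ea, hg2])
  have hA1 : (1 : ℝ) ≤ A := by exact_mod_cast hAp
  have hB1 : (1 : ℝ) ≤ B := by exact_mod_cast hBp
  have hC1 : (1 : ℝ) ≤ C := by exact_mod_cast hCp
  have hα1 : 3 / 2 ≤ α := by rw [hα]; linarith
  have hβ2 : 2 ≤ β := by
    have : (1 : ℝ) ≤ A * B * C := by exact_mod_cast Nat.mul_pos (Nat.mul_pos hAp hBp) hCp
    rw [hβ]; linarith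
  have hαβ : 4 * α ≤ 2 * α * β := by nlinarith
  have hkreal : ((2 * α * β - 1) ^ 2 - 4 * α ^ 2) / (4 * β) + α < k := by
    have h := Int.lt_floor_add_one (((2 * α * β - 1) ^ 2 - 4 * α ^ 2) / (4 * β) + α)
    have h' : (M : ℝ) ≤ k := by exact_mod_cast hk
    rw [hM] at h'
    push_cast at h'
    linarith
  have hkpos : 0 < k := by
    have : 0 ≤ ((2 * α * β - 1) ^ 2 - 4 * α ^ 2) / (4 * β) :=
      div_nonneg (by nlinarith) (by linarith)
    have : (0 : ℝ) < k := by linarith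
    exact_mod_cast this
  have hγ0 : 0 ≤ γ := by
    rw [hγ, Int.floor_nonneg, sub_nonneg]
    refine Real.le_sqrt_of_sq_le ?_
    have : 0 ≤ β * ((k : ℝ) + α) := by positivity
    linarith
  lift γ to ℕ using hγ0
  have hsol' : numSol A B C γ = k := by
    rw [← hsol, numSol]
    congr 1
    ext p
    simp only [Set.mem_ofPred_eq]
    norm_cast
  have hbound : ∀ m, numSol A B C m = k → |(k : ℝ) - m * (m + 2 * α) / β| ≤ α := by
    intro m hm
    have h := abs_numSol_sub_le hAp hBp hCp hAB hBC hCA m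
    rw [hm] at h
    rw [hα, hβ]
    convert h using 5
    ring
  have hlt : ∀ m n : ℕ, numSol A B C m = k → numSol A B C n = k → m < n + 1 := by
    intro m n hm hn
    have := window_unique (by linarith) (by linarith) hkreal (Nat.cast_nonneg m)
      (Nat.cast_nonneg n) (hbound m hm) (hbound n hn)
    exact_mod_cast this
  have hunique : ∀ m, numSol A B C m = k ↔ m = γ := by
    intro m
    refine ⟨fun hm => ?_, fun hm => hm ▸ hsol'⟩
    have := hlt m γ hm hsol'
    have := hlt γ m hsol' hm
    omega
  have h := ncard_numSol_eq (g₁ := g1) (g₂ := g2) (g₃ := g3) (by rw [ea, hg1]; exact hbca)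
    (by rw [eb, hg2]; exact hcab) (by rw [ec, hg3]; exact habc) hg1p hg2p hg3p hkpos hunique
  rwa [ea, eb, ec] at h
end

section
/- Let a, b, c be positive integers with gcd(a,b,c) = 1, with g_1 = gcd(b,c), g_2 = gcd(c,a), g_3 = gcd(a,b), A = a/(g_2 g_3), B = b/(g_3 g_1), C = c/(g_1 g_2), α' = (A+B+C)/2, β' = 2ABC, M' = ⌊((2α'β'−1)² − 4α'²)/(4β') + α'⌋ + 1, γ'_k = ⌊√(β'(k+α') + α'²) − α'⌋ and δ'_k = ⌊√(β'(k−α') + α'²) − α'⌋. Suppose k ≥ M', γ'_k ≠ δ'_k, and the equation Ax + By + Cz = γ'_k has exactly k nonnegative integer solutions. Then the largest element of R_k(a,b,c) is g_1 g_2 g_3 · γ'_k + a(g_1 − 1) + b(g_2 − 1) + c(g_3 − 1); that is, g_{=k}(a,b,c) = g_1 g_2 g_3 γ'_k + a(g_1−1) + b(g_2−1) + c(g_3−1). -/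
open Finset in
/-- The partial sums of a `B`-periodic enumeration of the residues modulo `B` exceed their mean
by at most `B * (B - 1) / 2`. -/
theorem two_mul_sum_range_le_of_periodic (B : ℕ) (f : ℕ → ℕ) (hB : 0 < B)
    (hlt : ∀ z, f z < B) (hper : ∀ z, f (B + z) = f z)
    (hsum : 2 * ∑ z ∈ range B, f z = B * (B - 1)) (Z : ℕ) :
    2 * ∑ z ∈ range Z, f z ≤ (Z + B) * (B - 1) := by
  induction Z using Nat.strong_induction_on with
  | _ Z ih =>
    rcases lt_or_ge Z B with h | h
    · have h1 : ∑ z ∈ range Z, f z ≤ Z * (B - 1) := by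
        simpa using sum_le_card_nsmul (range Z) f (B - 1) fun z _ => Nat.le_sub_one_of_lt (hlt z)
      nlinarith
    · obtain ⟨Y, rfl⟩ := Nat.exists_eq_add_of_le h
      have h1 := ih Y (by omega)
      rw [sum_range_add, mul_add, hsum]
      simp only [hper]
      nlinarith

open Finset in
theorem ZMod.two_mul_sum_val (B : ℕ) [NeZero B] :
    2 * ∑ x : ZMod B, x.val = B * (B - 1) := by
  have h : ∑ x : ZMod B, x.val = ∑ i ∈ range B, i := by
    obtain ⟨m, rfl⟩ := Nat.exists_eq_add_one_of_ne_zero (NeZero.ne B)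
    exact Fin.sum_univ_eq_sum_range (fun i => i) (m + 1)
  rw [h, mul_comm, sum_range_id_mul_two]

open Finset in
/-- Along the progression `n - C * z`, the least nonnegative solutions `u` of `A * u ≡ n - C * z`
modulo `B` are almost equidistributed. -/
theorem exists_residue_with_small_sum (A B C : ℕ) (hB : 0 < B) (hAB : Nat.Coprime A B)
    (hCB : Nat.Coprime C B) (n : ℕ) :
    ∃ u : ℕ → ℕ, (∀ z, u z < B) ∧ (∀ z, (B : ℤ) ∣ (n : ℤ) - C * z - A * u z) ∧
      ∀ Z, 2 * ∑ z ∈ range Z, u z ≤ (Z + B) * (B - 1) := by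
  have : NeZero B := ⟨hB.ne'⟩
  have hA : (A : ZMod B) * (A : ZMod B)⁻¹ = 1 := ZMod.coe_mul_inv_eq_one A hAB
  have hC : (C : ZMod B) * (C : ZMod B)⁻¹ = 1 := ZMod.coe_mul_inv_eq_one C hCB
  let e : ZMod B → ZMod B := fun z => (A : ZMod B)⁻¹ * (n - C * z)
  have he : Function.Injective e := by
    intro x y hxy
    have h1 : (A : ZMod B) * e x = A * e y := by rw [hxy]
    simp only [e, ← mul_assoc, hA, one_mul] at h1
    have h2 : (C : ZMod B)⁻¹ * (C * x) = (C : ZMod B)⁻¹ * (C * y) := by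
      rw [sub_right_inj.mp h1]
    rwa [← mul_assoc, ← mul_assoc, mul_comm (C : ZMod B)⁻¹, hC, one_mul, one_mul] at h2
  refine ⟨fun z => (e z).val, fun z => ZMod.val_lt _, fun z => ?_, ?_⟩
  · rw [← ZMod.intCast_zmod_eq_zero_iff_dvd]
    push_cast
    rw [ZMod.natCast_zmod_val]
    simp only [e, ← mul_assoc, hA, one_mul, sub_self]
  · refine two_mul_sum_range_le_of_periodic B _ hB (fun z => ZMod.val_lt _) (fun z => by simp) ?_
    rw [← ZMod.two_mul_sum_val B]
    congr 1
    rw [← (Finite.injective_iff_bijective.mp he).sum_comp fun x => x.val]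
    refine sum_bij (fun z _ => (z : ZMod B)) (by simp) ?_ ?_ (by simp)
    · intro x hx y hy hxy
      rw [mem_range] at hx hy
      have := congrArg ZMod.val hxy
      rwa [ZMod.val_natCast_of_lt hx, ZMod.val_natCast_of_lt hy] at this
    · intro x _
      exact ⟨x.val, by simpa using ZMod.val_lt x, by simp⟩

theorem finite_setOf_linear_eq (A B C : ℕ) (hA : 0 < A) (hB : 0 < B) (hC : 0 < C) (n : ℕ) :
    {p : ℕ × ℕ × ℕ | (A : ℤ) * p.1 + (B : ℤ) * p.2.1 + (C : ℤ) * p.2.2 = n}.Finite := by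
  refine ((Set.finite_Iic n).prod ((Set.finite_Iic n).prod (Set.finite_Iic n))).subset ?_
  rintro ⟨x, y, z⟩ h
  simp only [Set.mem_ofPred_eq] at h
  norm_cast at h
  simp only [Set.mem_prod, Set.mem_Iic]
  refine ⟨?_, ?_, ?_⟩ <;> nlinarith [Nat.zero_le (A * x), Nat.zero_le (B * y), Nat.zero_le (C * z)]

open Finset in
/-- A quadratic lower bound for the denumerant of three pairwise coprime integers. -/
theorem quadratic_le_ncard_linear_eq (A B C : ℕ) (hA : 0 < A) (hB : 0 < B) (hC : 0 < C)
    (hAB : Nat.Coprime A B) (hCA : Nat.Coprime C A) (hCB : Nat.Coprime C B) (n : ℕ) :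
    (n : ℤ) ^ 2 + (A + B + C) * n - A * B * C * (A + B) ≤ 2 * A * B * C *
      ({p : ℕ × ℕ × ℕ |
        (A : ℤ) * p.1 + (B : ℤ) * p.2.1 + (C : ℤ) * p.2.2 = n}.ncard : ℤ) := by
  obtain ⟨u, -, hu, hus⟩ := exists_residue_with_small_sum A B C hB hAB hCB n
  obtain ⟨v, -, hv, hvs⟩ := exists_residue_with_small_sum B A C hA hAB.symm hCA n
  have hw : ∀ z : ℕ, ∃ w : ℤ, (n : ℤ) - C * z - A * u z - B * v z = A * B * w := by
    intro z
    refine IsCoprime.mul_dvd (Nat.isCoprime_iff_coprime.mpr hAB) ?_ ?_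
    · have := dvd_sub (hv z) (dvd_mul_right (A : ℤ) (u z))
      convert this using 1; ring
    · exact dvd_sub (hu z) (dvd_mul_right (B : ℤ) (v z))
  choose w hw using hw
  set S := {p : ℕ × ℕ × ℕ | (A : ℤ) * p.1 + (B : ℤ) * p.2.1 + (C : ℤ) * p.2.2 = n} with hS
  have hSfin : S.Finite := finite_setOf_linear_eq A B C hA hB hC n
  obtain ⟨s, hs, hns⟩ : ∃ s, s < C ∧ n = C * (n / C) + s :=
    ⟨n % C, Nat.mod_lt _ hC, (Nat.div_add_mod n C).symm⟩
  set q := n / C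
  have hcount : (∑ z ∈ range (q + 1), (w z + 1)) ≤ (S.ncard : ℤ) := by
    let T : Finset (Σ _ : ℕ, ℕ) := (range (q + 1)).sigma fun z => range (w z + 1).toNat
    let φ : (Σ _ : ℕ, ℕ) → ℕ × ℕ × ℕ :=
      fun t => (u t.1 + B * t.2, v t.1 + A * ((w t.1).toNat - t.2), t.1)
    have hφ : Set.InjOn φ T := by
      rintro ⟨z, i⟩ - ⟨z', i'⟩ - h
      simp only [φ, Prod.mk.injEq] at h
      obtain ⟨h1, -, rfl⟩ := h
      have : i = i' := Nat.eq_of_mul_eq_mul_left hB (Nat.add_left_cancel h1)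
      rw [this]
    have hsub : φ '' T ⊆ S := by
      rintro _ ⟨⟨z, i⟩, ht, rfl⟩
      simp only [T, coe_sigma, Set.mem_sigma_iff, mem_coe, mem_range] at ht
      obtain ⟨m, hm⟩ : ∃ m : ℕ, w z = m + i := ⟨(w z - i).toNat, by omega⟩
      have hm' : (w z).toNat - i = m := by omega
      simp only [hS, φ, Set.mem_ofPred_eq, hm']
      have := hw z
      rw [hm] at this
      push_cast
      linarith
    have hT : (T : Set (Σ _ : ℕ, ℕ)).ncard ≤ S.ncard := by
      rw [← hφ.ncard_image]
      exact Set.ncard_le_ncard hsub hSfin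
    rw [Set.ncard_coe_finset, card_sigma] at hT
    simp only [card_range] at hT
    calc ∑ z ∈ range (q + 1), (w z + 1) ≤ ∑ z ∈ range (q + 1), ((w z + 1).toNat : ℤ) :=
          sum_le_sum fun z _ => Int.self_le_toNat _
      _ ≤ (S.ncard : ℤ) := by rw [← Nat.cast_sum]; exact Nat.cast_le.mpr hT
  have hsum : (A : ℤ) * B * ∑ z ∈ range (q + 1), (w z + 1) =
      (q + 1) * n - C * ∑ z ∈ range (q + 1), (z : ℤ) - A * ∑ z ∈ range (q + 1), (u z : ℤ)
        - B * ∑ z ∈ range (q + 1), (v z : ℤ) + (q + 1) * (A * B) := by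
    have h : ∀ z ∈ range (q + 1), (A : ℤ) * B * (w z + 1) =
        n - C * z - A * u z - B * v z + A * B := fun z _ => by rw [hw z]; ring
    rw [mul_sum, sum_congr rfl h]
    simp only [sum_add_distrib, sum_sub_distrib, ← mul_sum, sum_const, card_range, nsmul_eq_mul]
    push_cast
    ring
  have hid : 2 * ∑ z ∈ range (q + 1), (z : ℤ) = (q + 1) * q := by
    have := sum_range_id_mul_two (q + 1)
    zify at this
    simp only [Nat.add_sub_cancel] at this
    linarith
  have hU : 2 * ∑ z ∈ range (q + 1), (u z : ℤ) ≤ (q + 1 + B) * (B - 1) := by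
    have := hus (q + 1)
    zify [hB] at this
    exact this
  have hV : 2 * ∑ z ∈ range (q + 1), (v z : ℤ) ≤ (q + 1 + A) * (A - 1) := by
    have := hvs (q + 1)
    zify [hA] at this
    exact this
  have hmain : 2 * ((q : ℤ) + 1) * n - C * ((q + 1) * q) - A * ((q + 1 + B) * (B - 1))
      - B * ((q + 1 + A) * (A - 1)) + 2 * (q + 1) * (A * B) ≤ 2 * A * B * S.ncard := by
    have h1 := mul_le_mul_of_nonneg_left hcount (by positivity : (0 : ℤ) ≤ 2 * A * B)
    have h2 := mul_le_mul_of_nonneg_left hU (Int.natCast_nonneg A)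
    have h3 := mul_le_mul_of_nonneg_left hV (Int.natCast_nonneg B)
    have h4 : (C : ℤ) * (2 * ∑ z ∈ range (q + 1), (z : ℤ)) = C * ((q + 1) * q) := by rw [hid]
    linarith
  have hmain' := mul_le_mul_of_nonneg_left hmain (Int.natCast_nonneg C)
  have hn : (n : ℤ) = C * q + s := by exact_mod_cast hns
  have hsC : (0 : ℤ) ≤ (C - s) * (s + A + B) :=
    mul_nonneg (by linarith [(by exact_mod_cast hs : (s : ℤ) < C)]) (by positivity)
  have hABC : (0 : ℤ) ≤ A * B * C := by positivity
  rw [hn] at hmain' ⊢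
  linarith

/-- Reduction to pairwise coprime coefficients: the solutions of `a * x + b * y + c * z = t` are
those with `x`, `y`, `z` in fixed residue classes modulo `g1`, `g2`, `g3`. -/
theorem numSol_eq_ncard_of_eq_mul (g1 g2 g3 A B C x0 y0 z0 t : ℕ) (n : ℤ)
    (h1 : Nat.Coprime g1 (g2 * g3 * A)) (h2 : Nat.Coprime g2 (g3 * g1 * B))
    (h3 : Nat.Coprime g3 (g1 * g2 * C)) (hx0 : x0 < g1) (hy0 : y0 < g2) (hz0 : z0 < g3)
    (ht : (t : ℤ) = g1 * g2 * g3 * n + (g2 * g3 * A : ℕ) * x0 + (g3 * g1 * B : ℕ) * y0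
      + (g1 * g2 * C : ℕ) * z0) :
    numSol (g2 * g3 * A) (g3 * g1 * B) (g1 * g2 * C) t =
      {p : ℕ × ℕ × ℕ | (A : ℤ) * p.1 + (B : ℤ) * p.2.1 + (C : ℤ) * p.2.2 = n}.ncard := by
  have key : ∀ g r x₀ x : ℕ, Nat.Coprime g r → x₀ < g → (g : ℤ) ∣ r * ((x : ℤ) - x₀) →
      x = x₀ + g * (x / g) := by
    intro g r x₀ x hgr hx₀ hdvd
    have h := (Nat.isCoprime_iff_coprime.mpr hgr).dvd_of_dvd_mul_left hdvd
    have h' : x₀ ≡ x [MOD g] := (Nat.modEq_iff_dvd).mpr h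
    rw [Nat.ModEq, Nat.mod_eq_of_lt hx₀] at h'
    rw [h', Nat.mod_add_div]
  let φ : ℕ × ℕ × ℕ → ℕ × ℕ × ℕ :=
    fun p => (x0 + g1 * p.1, y0 + g2 * p.2.1, z0 + g3 * p.2.2)
  have hg : (g1 * g2 * g3 : ℤ) ≠ 0 := by
    have : 0 < g1 := by omega
    have : 0 < g2 := by omega
    have : 0 < g3 := by omega
    positivity
  have hφ : Function.Injective φ := by
    rintro ⟨x, y, z⟩ ⟨x', y', z'⟩ h
    simp only [φ, Prod.mk.injEq, Nat.add_left_cancel_iff] at h ⊢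
    exact ⟨Nat.eq_of_mul_eq_mul_left (by omega) h.1, Nat.eq_of_mul_eq_mul_left (by omega) h.2.1,
      Nat.eq_of_mul_eq_mul_left (by omega) h.2.2⟩
  have hiff : ∀ p : ℕ × ℕ × ℕ,
      (g2 * g3 * A * (φ p).1 + g3 * g1 * B * (φ p).2.1 + g1 * g2 * C * (φ p).2.2 = t ↔
        (A : ℤ) * p.1 + (B : ℤ) * p.2.1 + (C : ℤ) * p.2.2 = n) := by
    intro p
    rw [← Nat.cast_inj (R := ℤ), ht]
    simp only [φ]
    push_cast
    constructor
    · intro h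
      apply mul_left_cancel₀ hg
      linarith
    · rintro rfl
      ring
  rw [numSol]
  refine Eq.trans (congrArg Set.ncard ?_) (Set.ncard_image_of_injective _ hφ)
  ext ⟨x, y, z⟩
  simp only [Set.mem_ofPred_eq, Set.mem_image]
  constructor
  · intro h
    have hz := congrArg (Nat.cast : ℕ → ℤ) h
    rw [ht] at hz
    push_cast at hz
    have hx := key g1 _ x0 x h1 hx0 ⟨g2 * g3 * n + g3 * B * (y0 - y) + g2 * C * (z0 - z), by
      push_cast; linarith⟩
    have hy := key g2 _ y0 y h2 hy0 ⟨g1 * g3 * n + g3 * A * (x0 - x) + g1 * C * (z0 - z), by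
      push_cast; linarith⟩
    have hz := key g3 _ z0 z h3 hz0 ⟨g1 * g2 * n + g2 * A * (x0 - x) + g1 * B * (y0 - y), by
      push_cast; linarith⟩
    have hp : φ (x / g1, y / g2, z / g3) = (x, y, z) := by
      simp only [φ, ← hx, ← hy, ← hz]
    refine ⟨_, (hiff _).mp ?_, hp⟩
    rw [hp]
    exact h
  · rintro ⟨p, hp, hpe⟩
    have := (hiff p).mpr hp
    rwa [hpe] at this

theorem exists_lt_dvd_sub_mul (g r t : ℕ) (hg : 0 < g) (h : Nat.Coprime g r) :
    ∃ x, x < g ∧ (g : ℤ) ∣ t - r * x := by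
  obtain ⟨u, hu, hu', -⟩ := exists_residue_with_small_sum r g 1 hg h.symm (Nat.coprime_one_left g) t
  exact ⟨u 0, hu 0, by simpa using hu' 0⟩

/-- Every integer is of the form required in `numSol_eq_ncard_of_eq_mul`. -/
theorem exists_eq_mul_add_residues (g1 g2 g3 A B C t : ℕ) (hg1 : 0 < g1) (hg2 : 0 < g2)
    (hg3 : 0 < g3) (h1 : Nat.Coprime g1 (g2 * g3 * A)) (h2 : Nat.Coprime g2 (g3 * g1 * B))
    (h3 : Nat.Coprime g3 (g1 * g2 * C)) :
    ∃ (x0 y0 z0 : ℕ) (n : ℤ), x0 < g1 ∧ y0 < g2 ∧ z0 < g3 ∧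
      (t : ℤ) = g1 * g2 * g3 * n + (g2 * g3 * A : ℕ) * x0 + (g3 * g1 * B : ℕ) * y0
        + (g1 * g2 * C : ℕ) * z0 := by
  obtain ⟨x, hx, p, hp⟩ := exists_lt_dvd_sub_mul g1 _ t hg1 h1
  obtain ⟨y, hy, q, hq⟩ := exists_lt_dvd_sub_mul g2 _ t hg2 h2
  obtain ⟨z, hz, r, hr⟩ := exists_lt_dvd_sub_mul g3 _ t hg3 h3
  push_cast at hp hq hr
  have c12 : IsCoprime (g1 : ℤ) g2 :=
    Nat.isCoprime_iff_coprime.mpr (h1.coprime_dvd_right ⟨g3 * A, by ring⟩)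
  have c13 : IsCoprime (g1 : ℤ) g3 :=
    Nat.isCoprime_iff_coprime.mpr (h1.coprime_dvd_right ⟨g2 * A, by ring⟩)
  have c23 : IsCoprime (g2 : ℤ) g3 :=
    Nat.isCoprime_iff_coprime.mpr (h2.coprime_dvd_right ⟨g1 * B, by ring⟩)
  obtain ⟨n, hn⟩ : (g1 * g2 * g3 : ℤ) ∣
      t - g2 * g3 * A * x - g3 * g1 * B * y - g1 * g2 * C * z := by
    refine IsCoprime.mul_dvd (c13.mul_left c23) (IsCoprime.mul_dvd c12 ?_ ?_) ?_
    · exact ⟨p - g3 * B * y - g2 * C * z, by linarith⟩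
    · exact ⟨q - g3 * A * x - g1 * C * z, by linarith⟩
    · exact ⟨r - g2 * A * x - g1 * B * y, by linarith⟩
  exact ⟨x, y, z, n, hx, hy, hz, by push_cast; linarith⟩

theorem stmt_11 (a b c : ℕ)
    (ha : 0 < a) (hb : 0 < b) (hc : 0 < c)
    (habc : Nat.gcd (Nat.gcd a b) c = 1)
    (g1 g2 g3 : ℕ) (hg1 : g1 = Nat.gcd b c) (hg2 : g2 = Nat.gcd c a)
    (hg3 : g3 = Nat.gcd a b)
    (A B C : ℕ) (hA : A = a / (g2 * g3)) (hB : B = b / (g3 * g1))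
    (hC : C = c / (g1 * g2))
    (α β : ℝ) (hα : α = ((A : ℝ) + B + C) / 2) (hβ : β = 2 * A * B * C)
    (M : ℤ) (hM : M = ⌊((2 * α * β - 1) ^ 2 - 4 * α ^ 2) / (4 * β) + α⌋ + 1)
    (k : ℕ)
    (γ δ : ℤ)
    (hγ : γ = ⌊Real.sqrt (β * ((k : ℝ) + α) + α ^ 2) - α⌋)
    (hδ : δ = ⌊Real.sqrt (β * ((k : ℝ) - α) + α ^ 2) - α⌋)
    (hk : M ≤ (k : ℤ)) (hγδ : γ ≠ δ)
    (hsol : {p : ℕ × ℕ × ℕ |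
      (A : ℤ) * p.1 + (B : ℤ) * p.2.1 + (C : ℤ) * p.2.2 = γ}.ncard = k) :
    IsGreatest ((fun t : ℕ => (t : ℤ)) '' {t : ℕ | numSol a b c t = k})
      ((g1 : ℤ) * g2 * g3 * γ + a * ((g1 : ℤ) - 1) + b * ((g2 : ℤ) - 1)
        + c * ((g3 : ℤ) - 1)) := by
  have pg1 : 0 < g1 := hg1 ▸ Nat.gcd_pos_of_pos_left _ hb
  have pg2 : 0 < g2 := hg2 ▸ Nat.gcd_pos_of_pos_left _ hc
  have pg3 : 0 < g3 := hg3 ▸ Nat.gcd_pos_of_pos_left _ ha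
  have unit : ∀ d, d ∣ a → d ∣ b → d ∣ c → d ∣ 1 := fun d h h' h'' =>
    habc ▸ Nat.dvd_gcd (Nat.dvd_gcd h h') h''
  have g1b : g1 ∣ b := hg1 ▸ Nat.gcd_dvd_left b c
  have g1c : g1 ∣ c := hg1 ▸ Nat.gcd_dvd_right b c
  have g2c : g2 ∣ c := hg2 ▸ Nat.gcd_dvd_left c a
  have g2a : g2 ∣ a := hg2 ▸ Nat.gcd_dvd_right c a
  have g3a : g3 ∣ a := hg3 ▸ Nat.gcd_dvd_left a b
  have g3b : g3 ∣ b := hg3 ▸ Nat.gcd_dvd_right a b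
  have c1 : Nat.Coprime g1 a := Nat.dvd_one.mp (unit _ (Nat.gcd_dvd_right _ _)
    ((Nat.gcd_dvd_left _ _).trans g1b) ((Nat.gcd_dvd_left _ _).trans g1c))
  have c2 : Nat.Coprime g2 b := Nat.dvd_one.mp (unit _ ((Nat.gcd_dvd_left _ _).trans g2a)
    (Nat.gcd_dvd_right _ _) ((Nat.gcd_dvd_left _ _).trans g2c))
  have c3 : Nat.Coprime g3 c := Nat.dvd_one.mp (unit _ ((Nat.gcd_dvd_left _ _).trans g3a)
    ((Nat.gcd_dvd_left _ _).trans g3b) (Nat.gcd_dvd_right _ _))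
  have ea : a = g2 * g3 * A := by
    rw [hA, Nat.mul_div_cancel' ((c2.coprime_dvd_right g3b).mul_dvd_of_dvd_of_dvd g2a g3a)]
  have eb : b = g3 * g1 * B := by
    rw [hB, Nat.mul_div_cancel' ((c3.coprime_dvd_right g1c).mul_dvd_of_dvd_of_dvd g3b g1b)]
  have ec : c = g1 * g2 * C := by
    rw [hC, Nat.mul_div_cancel' ((c1.coprime_dvd_right g2a).mul_dvd_of_dvd_of_dvd g1c g2c)]
  clear hA hB hC
  have pA : 0 < A := Nat.pos_of_ne_zero fun h => by simp [h] at ea; omega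
  have pB : 0 < B := Nat.pos_of_ne_zero fun h => by simp [h] at eb; omega
  have pC : 0 < C := Nat.pos_of_ne_zero fun h => by simp [h] at ec; omega
  have coprime_of : ∀ g x y X Y : ℕ, 0 < g → g = Nat.gcd x y → g * X ∣ x → g * Y ∣ y →
      Nat.Coprime X Y := by
    intro g x y X Y hg hgcd hx hy
    refine Nat.dvd_one.mp (Nat.dvd_of_mul_dvd_mul_left hg ?_)
    rw [mul_one, ← Nat.gcd_mul_left]
    exact (Nat.gcd_dvd_gcd_of_dvd_left _ hx).trans
      ((Nat.gcd_dvd_gcd_of_dvd_right _ hy).trans hgcd.symm.dvd)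
  have hAB : Nat.Coprime A B := coprime_of g3 a b A B pg3 hg3
    ⟨g2, by rw [ea]; ring⟩ ⟨g1, by rw [eb]; ring⟩
  have hCA : Nat.Coprime C A := coprime_of g2 c a C A pg2 hg2
    ⟨g1, by rw [ec]; ring⟩ ⟨g3, by rw [ea]; ring⟩
  have hCB : Nat.Coprime C B := (coprime_of g1 b c B C pg1 hg1
    ⟨g3, by rw [eb]; ring⟩ ⟨g2, by rw [ec]; ring⟩).symm
  have hα0 : 0 ≤ α := by rw [hα]; positivity
  have hβ0 : 0 ≤ β := by rw [hβ]; positivity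
  have hγ0 : 0 ≤ γ := by
    rw [hγ, Int.floor_nonneg, sub_nonneg]
    exact Real.le_sqrt_of_sq_le (by nlinarith [mul_nonneg hβ0 (by positivity : 0 ≤ (k : ℝ) + α)])
  have hbound : ∀ n : ℕ, γ < n → {p : ℕ × ℕ × ℕ |
      (A : ℤ) * p.1 + (B : ℤ) * p.2.1 + (C : ℤ) * p.2.2 = n}.ncard ≠ k := by
    intro n hn hcard
    have h1 := quadratic_le_ncard_linear_eq A B C pA pB pC hAB hCA hCB n
    rw [hcard] at h1
    have h2 : Real.sqrt (β * ((k : ℝ) + α) + α ^ 2) < n + α := by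
      rw [hγ, Int.floor_lt] at hn
      push_cast at hn
      linarith
    rw [Real.sqrt_lt' (by rcases Nat.eq_zero_or_pos n with h | h
                          · subst h; push_cast at hn; omega
                          · positivity)] at h2
    have h3 : (n : ℝ) ^ 2 + (A + B + C) * n - A * B * C * (A + B) ≤ 2 * A * B * C * k := by
      exact_mod_cast h1
    have h4 : (0 : ℝ) ≤ A * B * C * C := by positivity
    rw [hβ, hα] at h2
    linarith
  subst ea eb ec
  constructor
  · lift γ to ℕ using hγ0
    refine ⟨g1 * g2 * g3 * γ + g2 * g3 * A * (g1 - 1) + g3 * g1 * B * (g2 - 1)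
      + g1 * g2 * C * (g3 - 1), ?_, by push_cast [pg1, pg2, pg3]; ring⟩
    rw [Set.mem_ofPred_eq, numSol_eq_ncard_of_eq_mul g1 g2 g3 A B C (g1 - 1) (g2 - 1) (g3 - 1) _ γ
      c1 c2 c3 (by omega) (by omega) (by omega) (by push_cast; ring)]
    exact hsol
  · rintro _ ⟨t, ht, rfl⟩
    obtain ⟨x, y, z, n, hx, hy, hz, htn⟩ :=
      exists_eq_mul_add_residues g1 g2 g3 A B C t pg1 pg2 pg3 c1 c2 c3
    rw [Set.mem_ofPred_eq, numSol_eq_ncard_of_eq_mul g1 g2 g3 A B C x y z t n c1 c2 c3 hx hy hz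
      htn] at ht
    have hnγ : n ≤ γ := by
      by_contra! hlt
      lift n to ℕ using by omega
      exact hbound n hlt ht
    simp only [htn]
    have hx' : (x : ℤ) ≤ g1 - 1 := by omega
    have hy' : (y : ℤ) ≤ g2 - 1 := by omega
    have hz' : (z : ℤ) ≤ g3 - 1 := by omega
    gcongr
end

section
/- Let a, b, c be positive integers with gcd(a,b,c) = 1, with g_1 = gcd(b,c), g_2 = gcd(c,a), g_3 = gcd(a,b), A = a/(g_2 g_3), B = b/(g_3 g_1), C = c/(g_1 g_2), α' = (A+B+C)/2, β' = 2ABC, M' = ⌊((2α'β'−1)² − 4α'²)/(4β') + α'⌋ + 1, γ'_k = ⌊√(β'(k+α') + α'²) − α'⌋ and δ'_k = ⌊√(β'(k−α') + α'²) − α'⌋. Suppose k ≥ M', γ'_k ≠ δ'_k, and the equation Ax + By + Cz = γ'_k has exactly k nonnegative integer solutions. Then the sum of the elements of R_k(a,b,c) equals (g_1 g_2 g_3)² γ'_k + (g_1 g_2 g_3)·(a·g_1(g_1−1) + b·g_2(g_2−1) + c·g_3(g_3−1))/(2 g_1 g_2 g_3) · g_1 g_2 g_3 /(g_1 g_2 g_3);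 explicitly, s_{=k}(a,b,c) = Σ_{i_1=0}^{g_1−1} Σ_{i_2=0}^{g_2−1} Σ_{i_3=0}^{g_3−1} ( g_1 g_2 g_3 γ'_k + a·i_1 + b·i_2 + c·i_3 ). -/
open Finset in
/-- Partial sums of the residues along an arithmetic progression modulo `A` whose common difference
is a unit stay close to their mean. -/
theorem abs_two_mul_sum_val_sub_le (A : ℕ) [NeZero A] (c : ZMod A) (hc : IsUnit c) (m : ℕ) :
    ∀ u : ZMod A,
      |2 * ∑ i ∈ range m, ((u + i * c).val : ℤ) - m * ((A : ℤ) - 1)| ≤ ((A : ℤ) - 1) ^ 2 := by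
  have hA : 0 < A := Nat.pos_of_ne_zero (NeZero.ne A)
  have hrange : ∀ g : ZMod A → ℤ, ∑ i ∈ range A, g (i : ZMod A) = ∑ z : ZMod A, g z := by
    intro g
    refine sum_bij' (fun i _ => (i : ZMod A)) (fun z _ => z.val) ?_ ?_ ?_ ?_ ?_
    · simp
    · intro z _
      simpa using ZMod.val_lt z
    · intro i hi
      exact ZMod.val_cast_of_lt (by simpa using hi)
    · simp
    · simp
  have hfull : ∀ u : ZMod A, 2 * ∑ i ∈ range A, ((u + i * c).val : ℤ) = A * ((A : ℤ) - 1) := by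
    intro u
    obtain ⟨w, rfl⟩ := hc
    have h0 : ∑ z : ZMod A, ((u + z * w).val : ℤ) = ∑ z : ZMod A, (z.val : ℤ) :=
      Equiv.sum_comp ((Units.mulRight w).trans (Equiv.addLeft u)) (fun z => (z.val : ℤ))
    rw [hrange (fun z => ((u + z * w).val : ℤ)), h0, ← hrange (fun z => (z.val : ℤ))]
    have h1 : ∑ i ∈ range A, (((i : ZMod A).val : ℕ) : ℤ) = ((∑ i ∈ range A, i : ℕ) : ℤ) := by
      push_cast
      refine sum_congr rfl fun i hi => ?_
      rw [ZMod.val_cast_of_lt (by simpa using hi)]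
    have h2 := sum_range_id_mul_two A
    zify [Nat.one_le_iff_ne_zero.mpr hA.ne'] at h2
    rw [h1]
    push_cast
    linarith
  induction m using Nat.strong_induction_on with
  | _ m ih =>
    intro u
    by_cases hm : m < A
    · have h1 : ∀ i ∈ range m,
          |2 * ((u + (i : ZMod A) * c).val : ℤ) - ((A : ℤ) - 1)| ≤ (A : ℤ) - 1 := by
        intro i _
        have := ZMod.val_lt (u + (i : ZMod A) * c)
        rw [abs_le]
        constructor <;> omega
      have h2 := (abs_sum_le_sum_abs (fun i : ℕ => 2 * ((u + i * c).val : ℤ) - ((A : ℤ) - 1))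
        (range m)).trans (sum_le_sum h1)
      rw [sum_sub_distrib, ← mul_sum] at h2
      simp only [sum_const, card_range, nsmul_eq_mul] at h2
      refine h2.trans ?_
      have h3 : (m : ℤ) ≤ A - 1 := by omega
      have h4 : (0 : ℤ) ≤ A - 1 := by omega
      nlinarith
    · obtain ⟨d, rfl⟩ := Nat.exists_eq_add_of_le (not_lt.mp hm)
      have h1 := ih d (by omega) u
      have h2 := hfull (u + (d : ZMod A) * c)
      have h3 : ∑ i ∈ range (A + d), ((u + i * c).val : ℤ) =
          ∑ i ∈ range d, ((u + i * c).val : ℤ) +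
            ∑ i ∈ range A, ((u + (d : ZMod A) * c + i * c).val : ℤ) := by
        rw [add_comm A d, sum_range_add]
        congr 1
        refine sum_congr rfl fun i _ => ?_
        push_cast
        ring_nf
      rw [h3]
      push_cast
      convert h1 using 2
      linarith

/-- The number of representations of `n` by two coprime positive integers. -/
theorem mul_ncard_two (A B : ℕ) [NeZero A] [NeZero B] (hAB : A.Coprime B) (n : ℕ) :
    (A : ℤ) * B * ({p : ℕ × ℕ | A * p.1 + B * p.2 = n}.ncard : ℤ) =
      n + A * B - A * (((A : ZMod B)⁻¹ * n).val : ℤ) - B * (((B : ZMod A)⁻¹ * n).val : ℤ) := by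
  have hA : 0 < A := Nat.pos_of_ne_zero (NeZero.ne A)
  have hB : 0 < B := Nat.pos_of_ne_zero (NeZero.ne B)
  set x := ((A : ZMod B)⁻¹ * n).val with hx
  set y := ((B : ZMod A)⁻¹ * n).val with hy
  have hxB : x < B := ZMod.val_lt _
  have hyA : y < A := ZMod.val_lt _
  have hxn : A * x ≡ n [MOD B] := by
    rw [← ZMod.natCast_eq_natCast_iff]
    push_cast
    rw [hx, ZMod.natCast_val, ZMod.cast_id, ← mul_assoc, ZMod.coe_mul_inv_eq_one A hAB, one_mul]
  have hyn : B * y ≡ n [MOD A] := by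
    rw [← ZMod.natCast_eq_natCast_iff]
    push_cast
    rw [hy, ZMod.natCast_val, ZMod.cast_id, ← mul_assoc, ZMod.coe_mul_inv_eq_one B hAB.symm,
      one_mul]
  have hle : A * x + B * y < n + 2 * (A * B) := by nlinarith
  have hmod : A * x + B * y ≡ n + A * B [MOD A * B] := by
    refine (Nat.modEq_and_modEq_iff_modEq_mul hAB).mp ⟨?_, ?_⟩
    · have h1 : A * x ≡ A * B [MOD A] :=
        ((Nat.modEq_zero_iff_dvd.mpr (dvd_mul_right _ _)).trans
          (Nat.modEq_zero_iff_dvd.mpr (dvd_mul_right _ _)).symm)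
      rw [add_comm n]
      exact h1.add hyn
    · have h1 : B * y ≡ A * B [MOD B] :=
        ((Nat.modEq_zero_iff_dvd.mpr (dvd_mul_right _ _)).trans
          (Nat.modEq_zero_iff_dvd.mpr (dvd_mul_left _ _)).symm)
      exact hxn.add h1
  obtain ⟨L, hL⟩ : ∃ L : ℕ, n + A * B = A * x + B * y + A * B * L := by
    obtain ⟨l, hl⟩ := (Nat.modEq_iff_dvd.mp hmod)
    push_cast at hl
    have hpos : (0 : ℤ) < A * B := by positivity
    have : 0 ≤ l := by
      by_contra hneg
      have h1 : l ≤ -1 := by omega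
      zify at hle
      nlinarith
    lift l to ℕ using this
    refine ⟨l, ?_⟩
    zify
    linarith
  have hset : {p : ℕ × ℕ | A * p.1 + B * p.2 = n} =
      (fun j : ℕ => (x + B * (L - 1 - j), y + A * j)) '' (Finset.range L : Set ℕ) := by
    ext ⟨p, q⟩
    simp only [Set.mem_ofPred_eq, Set.mem_image, Finset.coe_range, Set.mem_Iio, Prod.mk.injEq]
    constructor
    · intro h
      have h1 : A * p ≡ A * x [MOD B] := by
        refine Nat.ModEq.trans ?_ hxn.symm
        rw [← h]
        simp [Nat.ModEq]
      have h2 : B * q ≡ B * y [MOD A] := by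
        refine Nat.ModEq.trans ?_ hyn.symm
        rw [← h]
        simp [Nat.ModEq]
      have h3 : x ≡ p [MOD B] := (h1.cancel_left_of_coprime hAB.symm).symm
      have h4 : y ≡ q [MOD A] := (h2.cancel_left_of_coprime hAB).symm
      have h5 : x ≤ p := by
        have : p % B = x := by rw [← h3, Nat.mod_eq_of_lt hxB]
        rw [← this]; exact Nat.mod_le _ _
      have h6 : y ≤ q := by
        have : q % A = y := by rw [← h4, Nat.mod_eq_of_lt hyA]
        rw [← this]; exact Nat.mod_le _ _
      obtain ⟨i, hi⟩ := (Nat.modEq_iff_dvd' h5).mp h3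
      obtain ⟨j, hj⟩ := (Nat.modEq_iff_dvd' h6).mp h4
      have hp : p = x + B * i := by omega
      have hq : q = y + A * j := by omega
      have h7 : A * B * (i + j + 1) = A * B * L := by
        subst hp hq
        nlinarith
      have h8 : i + j + 1 = L := Nat.eq_of_mul_eq_mul_left (Nat.mul_pos hA hB) h7
      refine ⟨j, by omega, ?_, hq.symm⟩
      rw [hp, ← h8]
      congr 2
      omega
    · rintro ⟨j, hj, rfl, rfl⟩
      obtain ⟨i, rfl⟩ := Nat.exists_eq_add_of_lt hj
      have : j + i + 1 - 1 - j = i := by omega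
      rw [this]
      nlinarith
  have hcard : {p : ℕ × ℕ | A * p.1 + B * p.2 = n}.ncard = L := by
    rw [hset, Set.ncard_image_of_injective, Set.ncard_coe_finset, Finset.card_range]
    intro j j' h
    have := (Prod.mk.inj h).2
    exact Nat.eq_of_mul_eq_mul_left hA (Nat.add_left_cancel this)
  rw [hcard]
  zify at hL
  linarith

/-- Slicing the solutions of a ternary equation along the last variable. -/
theorem numSol_eq_sum_s13 (A B C : ℕ) (hA : 0 < A) (hB : 0 < B) (hC : 0 < C) (t : ℕ) :
    numSol A B C t = ∑ i ∈ Finset.range (t / C + 1),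
      {p : ℕ × ℕ | A * p.1 + B * p.2 = t % C + C * i}.ncard := by
  have hfin : ∀ n, {p : ℕ × ℕ | A * p.1 + B * p.2 = n}.Finite := by
    intro n
    refine ((Set.finite_Iic n).prod (Set.finite_Iic n)).subset ?_
    rintro ⟨p, q⟩ h
    simp only [Set.mem_ofPred_eq] at h
    simp only [Set.mem_prod, Set.mem_Iic]
    constructor <;> nlinarith
  have ht := Nat.mod_add_div t C
  have hset : {p : ℕ × ℕ × ℕ | A * p.1 + B * p.2.1 + C * p.2.2 = t} =
      ((Finset.range (t / C + 1)).sigma fun i => (hfin (t % C + C * i)).toFinset).image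
        (fun s => (s.2.1, s.2.2, t / C - s.1)) := by
    ext ⟨x, y, z⟩
    simp only [Set.mem_ofPred_eq, Finset.coe_image, Finset.coe_sigma, Set.mem_image,
      Set.mem_sigma_iff, Sigma.exists, Prod.exists, Prod.mk.injEq, Finset.coe_range, Set.mem_Iio,
      Set.Finite.coe_toFinset]
    constructor
    · intro h
      have hz : z ≤ t / C := by
        rw [Nat.le_div_iff_mul_le hC]
        nlinarith
      refine ⟨t / C - z, x, y, ⟨by omega, ?_⟩, rfl, rfl, by omega⟩
      obtain ⟨d, hd⟩ := Nat.exists_eq_add_of_le hz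
      rw [hd] at ht ⊢
      rw [Nat.add_sub_cancel_left]
      nlinarith
    · rintro ⟨i, x, y, ⟨hi, h⟩, rfl, rfl, rfl⟩
      obtain ⟨d, hd⟩ := Nat.exists_eq_add_of_le (Nat.lt_succ_iff.mp hi)
      rw [hd] at ht ⊢
      rw [Nat.add_sub_cancel_left]
      nlinarith
  unfold numSol
  rw [hset, Set.ncard_coe_finset, Finset.card_image_of_injOn, Finset.card_sigma]
  · exact Finset.sum_congr rfl fun i _ => (Set.ncard_eq_toFinset_card _ _).symm
  · rintro ⟨i, x, y⟩ h ⟨j, x', y'⟩ h' heq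
    simp only [Finset.coe_sigma, Set.mem_sigma_iff, Finset.coe_range, Set.mem_Iio] at h h'
    simp only [Prod.mk.injEq] at heq
    obtain ⟨rfl, rfl, h3⟩ := heq
    obtain rfl : i = j := by omega
    rfl

/-- Numerical estimates for the error term in the lattice point count. -/
theorem error_bounds {A B C r : ℤ} (hA : 1 ≤ A) (hB : 1 ≤ B) (hC : 1 ≤ C) (hr : 0 ≤ r)
    (hrC : r + 1 ≤ C) :
    (C - r) * (r + A + B) + C * A * (B - 1) ^ 2 + C * B * (A - 1) ^ 2 < A * B * C * (A + B + C) ∧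
      C * A * (B - 1) ^ 2 + C * B * (A - 1) ^ 2 ≤
        (C - r) * (r + A + B) + A * B * C * (A + B + C) := by
  have hAB : A + B ≤ A * B + 1 := by nlinarith
  have hABge : 1 ≤ A * B := by nlinarith
  have hABC : C ≤ A * B * C := by nlinarith
  constructor
  · have h1 : (C - r) * (r + A + B) ≤ C * (C - 1 + A + B) := by
      have h2 : 0 ≤ r * (A + B) := mul_nonneg hr (by linarith)
      have h3 : 0 ≤ (C - r) * (C - 1 - r) := mul_nonneg (by linarith) (by linarith)
      have h4 : 0 ≤ r * (C - 1) := mul_nonneg hr (by linarith)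
      linarith
    have h2 : 0 < C * (4 * (A * B) + A * B * C - (2 * A + 2 * B + C - 1)) := by
      apply mul_pos <;> linarith
    linarith
  · have h1 : 0 ≤ (C - r) * (r + A + B) := by
      apply mul_nonneg <;> linarith
    have h2 : 0 ≤ C * (4 * (A * B) + A * B * C - (A + B)) := by
      apply mul_nonneg <;> linarith
    linarith

/-- The number of representations by three pairwise coprime integers is close to a quadratic
polynomial. -/
theorem numSol_bounds (A B C : ℕ) (hA : 0 < A) (hB : 0 < B) (hC : 0 < C) (hAB : A.Coprime B)
    (hAC : A.Coprime C) (hBC : B.Coprime C) (t : ℕ) :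
    2 * (A : ℤ) * B * C * numSol A B C t < t * (t + A + B + C) + A * B * C * (A + B + C) ∧
      (t : ℤ) * (t + A + B + C) ≤ 2 * A * B * C * numSol A B C t + A * B * C * (A + B + C) := by
  have : NeZero A := ⟨hA.ne'⟩
  have : NeZero B := ⟨hB.ne'⟩
  set q := t / C with hq
  set r := t % C with hr
  have ht : (t : ℤ) = r + C * q := by
    exact_mod_cast (Nat.mod_add_div t C).symm
  have hrC : (r : ℤ) + 1 ≤ C := by exact_mod_cast Nat.mod_lt t hC
  have unit_of : ∀ D E : ℕ, D.Coprime E → IsUnit (D : ZMod E) := fun D E h =>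
    (ZMod.isUnit_iff_coprime D E).mpr h
  have inv_unit : ∀ D E : ℕ, D.Coprime E → IsUnit ((D : ZMod E)⁻¹) := fun D E h =>
    IsUnit.of_mul_eq_one (D : ZMod E) (by rw [mul_comm]; exact ZMod.coe_mul_inv_eq_one D h)
  have hX := abs_two_mul_sum_val_sub_le B ((A : ZMod B)⁻¹ * C)
    ((inv_unit A B hAB).mul (unit_of C B hBC.symm)) (q + 1) ((A : ZMod B)⁻¹ * r)
  have hY := abs_two_mul_sum_val_sub_le A ((B : ZMod A)⁻¹ * C)
    ((inv_unit B A hAB.symm).mul (unit_of C A hAC.symm)) (q + 1) ((B : ZMod A)⁻¹ * r)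
  set X := ∑ i ∈ Finset.range (q + 1),
    ((((A : ZMod B)⁻¹ * r + i * ((A : ZMod B)⁻¹ * C)).val : ℕ) : ℤ)
  set Y := ∑ i ∈ Finset.range (q + 1),
    ((((B : ZMod A)⁻¹ * r + i * ((B : ZMod A)⁻¹ * C)).val : ℕ) : ℤ)
  have hN : (A : ℤ) * B * numSol A B C t =
      ∑ i ∈ Finset.range (q + 1), ((r : ℤ) + C * i + A * B) - A * X - B * Y := by
    rw [numSol_eq_sum_s13 A B C hA hB hC, Nat.cast_sum, Finset.mul_sum, Finset.mul_sum, Finset.mul_sum,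
      ← Finset.sum_sub_distrib, ← Finset.sum_sub_distrib]
    refine Finset.sum_congr rfl fun i _ => ?_
    rw [mul_ncard_two A B hAB]
    have h1 : (A : ZMod B)⁻¹ * ((r + C * i : ℕ) : ZMod B) =
        (A : ZMod B)⁻¹ * r + i * ((A : ZMod B)⁻¹ * C) := by
      push_cast
      ring
    have h2 : (B : ZMod A)⁻¹ * ((r + C * i : ℕ) : ZMod A) =
        (B : ZMod A)⁻¹ * r + i * ((B : ZMod A)⁻¹ * C) := by
      push_cast
      ring
    rw [h1, h2]
    push_cast
    rfl
  have hsum : 2 * ∑ i ∈ Finset.range (q + 1), ((r : ℤ) + C * i + A * B) =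
      (q + 1) * (2 * r + C * q + 2 * A * B) := by
    clear_value q
    clear hX hY hN X Y hq ht
    induction q with
    | zero => simp; ring
    | succ n ih =>
      rw [Finset.sum_range_succ, mul_add, ih]
      push_cast
      ring
  rw [abs_le] at hX hY
  push_cast at hX hY
  obtain ⟨hX1, hX2⟩ := hX
  obtain ⟨hY1, hY2⟩ := hY
  generalize numSol A B C t = N at *
  have hA' : (1 : ℤ) ≤ A := by exact_mod_cast hA
  have hB' : (1 : ℤ) ≤ B := by exact_mod_cast hB
  have hC' : (1 : ℤ) ≤ C := by exact_mod_cast hC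
  have hr0 : (0 : ℤ) ≤ r := by positivity
  have hmain : 2 * (A : ℤ) * B * C * N = t * (t + A + B + C) + (C - r) * (r + A + B)
      - C * A * (2 * X - (q + 1) * (B - 1)) - C * B * (2 * Y - (q + 1) * (A - 1)) := by
    have : 2 * (A : ℤ) * B * C * N = C * (2 * (A * B * N)) := by ring
    rw [this, hN, mul_sub 2, mul_sub 2, hsum, ht]
    ring
  rw [hmain]
  generalize 2 * X - ((q : ℤ) + 1) * (B - 1) = E at *
  generalize 2 * Y - ((q : ℤ) + 1) * (A - 1) = F at *
  have hCA : (0 : ℤ) ≤ C * A := by positivity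
  have hCB : (0 : ℤ) ≤ C * B := by positivity
  have e1 := mul_le_mul_of_nonneg_left hX1 hCA
  have e2 := mul_le_mul_of_nonneg_left hX2 hCA
  have f1 := mul_le_mul_of_nonneg_left hY1 hCB
  have f2 := mul_le_mul_of_nonneg_left hY2 hCB
  have key := error_bounds hA' hB' hC' hr0 hrC
  constructor <;> linarith [key.1, key.2]

/-- A number with exactly `k` representations lies in the half-open interval bounded by the two
roots of the approximating quadratics. -/
theorem floor_lt_and_le_floor (A B C : ℕ) (hA : 0 < A) (hB : 0 < B) (hC : 0 < C)
    (hAB : A.Coprime B) (hAC : A.Coprime C) (hBC : B.Coprime C) (α β : ℝ)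
    (hα : α = ((A : ℝ) + B + C) / 2) (hβ : β = 2 * A * B * C) (t : ℕ) :
    ⌊Real.sqrt (β * ((numSol A B C t : ℝ) - α) + α ^ 2) - α⌋ < (t : ℤ) ∧
      (t : ℤ) ≤ ⌊Real.sqrt (β * ((numSol A B C t : ℝ) + α) + α ^ 2) - α⌋ := by
  obtain ⟨h1, h2⟩ := numSol_bounds A B C hA hB hC hAB hAC hBC t
  generalize numSol A B C t = k at *
  have h1' : 2 * (A : ℝ) * B * C * k < t * (t + A + B + C) + A * B * C * (A + B + C) := by
    exact_mod_cast h1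
  have h2' : (t : ℝ) * (t + A + B + C) ≤ 2 * A * B * C * k + A * B * C * (A + B + C) := by
    exact_mod_cast h2
  have hpos : 0 < (t : ℝ) + α := by
    rw [hα]
    positivity
  constructor
  · rw [Int.floor_lt]
    have : Real.sqrt (β * ((k : ℝ) - α) + α ^ 2) < t + α := by
      rw [Real.sqrt_lt' hpos, hα, hβ]
      linarith
    push_cast
    linarith
  · rw [Int.le_floor]
    have : t + α ≤ Real.sqrt (β * ((k : ℝ) + α) + α ^ 2) := by
      apply Real.le_sqrt_of_sq_le
      rw [hα, hβ]
      linarith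
    push_cast
    linarith

/-- For large `k` the two bounds differ by at most one. -/
theorem floor_sqrt_le_floor_sqrt_add_one {α β k : ℝ} (hβ : 0 < β)
    (hk : ((2 * α * β - 1) ^ 2 - 4 * α ^ 2) / (4 * β) + α < k) :
    ⌊Real.sqrt (β * (k + α) + α ^ 2) - α⌋ ≤ ⌊Real.sqrt (β * (k - α) + α ^ 2) - α⌋ + 1 := by
  have hk' : (2 * α * β - 1) ^ 2 - 4 * α ^ 2 < (k - α) * (4 * β) := by
    rw [← div_lt_iff₀ (by positivity)]
    linarith
  have hv0 : 0 ≤ β * (k - α) + α ^ 2 := by nlinarith [sq_nonneg (2 * α * β - 1)]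
  have hlt : Real.sqrt (β * (k + α) + α ^ 2) < Real.sqrt (β * (k - α) + α ^ 2) + 1 := by
    set v := Real.sqrt (β * (k - α) + α ^ 2) with hv
    have hvs : v ^ 2 = β * (k - α) + α ^ 2 := Real.sq_sqrt hv0
    have hvn : 0 ≤ v := Real.sqrt_nonneg _
    rw [Real.sqrt_lt' (by linarith)]
    have : α * β - 1 / 2 < v := by
      apply lt_of_pow_lt_pow_left₀ 2 hvn
      rw [hvs]
      linarith
    linarith
  rw [← Int.lt_add_one_iff, Int.floor_lt]
  have := Int.lt_floor_add_one (Real.sqrt (β * (k - α) + α ^ 2) - α)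
  push_cast
  linarith

/-- Reading off one variable of a linear equation modulo a divisor of the other terms. -/
theorem modEq_of_linear_eq {a b c g x y z x' y' z' u v : ℕ} (hb : g ∣ b) (hc : g ∣ c)
    (hga : g.Coprime a) (hu : g ∣ u) (hv : g ∣ v)
    (h : a * x + b * y + c * z + u = a * x' + b * y' + c * z' + v) : x ≡ x' [MOD g] := by
  refine Nat.ModEq.cancel_left_of_coprime (c := a) hga ?_
  rw [← ZMod.natCast_eq_natCast_iff]
  have hcast := congrArg (Nat.cast : ℕ → ZMod g) h
  push_cast at hcast ⊢
  simpa [(ZMod.natCast_eq_zero_iff _ _).mpr hb, (ZMod.natCast_eq_zero_iff _ _).mpr hc,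
    (ZMod.natCast_eq_zero_iff _ _).mpr hu, (ZMod.natCast_eq_zero_iff _ _).mpr hv] using hcast

/-- Reduction of the number of representations to pairwise coprime coefficients. -/
theorem numSol_reduction (g1 g2 g3 A B C : ℕ) (hg1 : 0 < g1) (hg2 : 0 < g2) (hg3 : 0 < g3)
    (h1 : g1.Coprime (g2 * g3 * A)) (h2 : g2.Coprime (g3 * g1 * B)) (h3 : g3.Coprime (g1 * g2 * C))
    (s i1 i2 i3 : ℕ) (hi1 : i1 < g1) (hi2 : i2 < g2) (hi3 : i3 < g3) :
    numSol (g2 * g3 * A) (g3 * g1 * B) (g1 * g2 * C)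
      (g1 * g2 * g3 * s + g2 * g3 * A * i1 + g3 * g1 * B * i2 + g1 * g2 * C * i3) =
      numSol A B C s := by
  have hset : {p : ℕ × ℕ × ℕ | g2 * g3 * A * p.1 + g3 * g1 * B * p.2.1 + g1 * g2 * C * p.2.2 =
      g1 * g2 * g3 * s + g2 * g3 * A * i1 + g3 * g1 * B * i2 + g1 * g2 * C * i3} =
      (fun p : ℕ × ℕ × ℕ => (i1 + g1 * p.1, i2 + g2 * p.2.1, i3 + g3 * p.2.2)) ''
        {p : ℕ × ℕ × ℕ | A * p.1 + B * p.2.1 + C * p.2.2 = s} := by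
    ext ⟨x, y, z⟩
    simp only [Set.mem_ofPred_eq, Set.mem_image, Prod.exists, Prod.mk.injEq]
    have lift : ∀ g i x : ℕ, i < g → x ≡ i [MOD g] → ∃ x', x = i + g * x' := by
      intro g i x hi h
      have : x % g = i := by rw [h, Nat.mod_eq_of_lt hi]
      exact ⟨x / g, by rw [← this, Nat.mod_add_div]⟩
    constructor
    · intro h
      obtain ⟨x', rfl⟩ := lift g1 i1 x hi1 (modEq_of_linear_eq (a := g2 * g3 * A)
        (b := g3 * g1 * B) (c := g1 * g2 * C) (y := y) (z := z) (y' := i2) (z' := i3)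
        (u := 0) (v := g1 * (g2 * g3 * s)) ⟨g3 * B, by ring⟩ ⟨g2 * C, by ring⟩ h1 (dvd_zero _)
        (dvd_mul_right _ _) (by linarith))
      obtain ⟨y', rfl⟩ := lift g2 i2 y hi2 (modEq_of_linear_eq (a := g3 * g1 * B)
        (b := g1 * g2 * C) (c := g2 * g3 * A) (y := z) (z := i1 + g1 * x') (y' := i3) (z' := i1)
        (u := 0) (v := g2 * (g1 * g3 * s)) ⟨g1 * C, by ring⟩ ⟨g3 * A, by ring⟩ h2 (dvd_zero _)
        (dvd_mul_right _ _) (by linarith))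
      obtain ⟨z', rfl⟩ := lift g3 i3 z hi3 (modEq_of_linear_eq (a := g1 * g2 * C)
        (b := g2 * g3 * A) (c := g3 * g1 * B) (y := i1 + g1 * x') (z := i2 + g2 * y') (y' := i1)
        (z' := i2) (u := 0) (v := g3 * (g1 * g2 * s)) ⟨g2 * A, by ring⟩ ⟨g1 * B, by ring⟩ h3
        (dvd_zero _) (dvd_mul_right _ _) (by linarith))
      refine ⟨x', y', z', ?_, rfl, rfl, rfl⟩
      apply Nat.eq_of_mul_eq_mul_left (Nat.mul_pos (Nat.mul_pos hg1 hg2) hg3)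
      linarith
    · rintro ⟨x', y', z', rfl, rfl, rfl, rfl⟩
      ring
  unfold numSol
  rw [hset, Set.ncard_image_of_injective]
  rintro ⟨x, y, z⟩ ⟨x', y', z'⟩ h
  simp only [Prod.mk.injEq, Nat.add_left_cancel_iff] at h
  obtain ⟨hx, hy, hz⟩ := h
  rw [Nat.eq_of_mul_eq_mul_left hg1 hx, Nat.eq_of_mul_eq_mul_left hg2 hy,
    Nat.eq_of_mul_eq_mul_left hg3 hz]

/-- The numbers with exactly `k` representations, when only `s` has exactly `k` representations by
the reduced coefficients. -/
theorem sum_numSol_eq (g1 g2 g3 A B C : ℕ) (hg1 : 0 < g1) (hg2 : 0 < g2) (hg3 : 0 < g3)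
    (h1 : g1.Coprime (g2 * g3 * A)) (h2 : g2.Coprime (g3 * g1 * B)) (h3 : g3.Coprime (g1 * g2 * C))
    (s k : ℕ) (hk : 0 < k) (hs : ∀ t, numSol A B C t = k ↔ t = s) :
    ∑ᶠ t ∈ {t : ℕ | numSol (g2 * g3 * A) (g3 * g1 * B) (g1 * g2 * C) t = k}, (t : ℤ) =
      ∑ i1 ∈ Finset.range g1, ∑ i2 ∈ Finset.range g2, ∑ i3 ∈ Finset.range g3,
        ((g1 : ℤ) * g2 * g3 * s + (g2 * g3 * A : ℕ) * i1 + (g3 * g1 * B : ℕ) * i2 +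
          (g1 * g2 * C : ℕ) * i3) := by
  set I := Finset.range g1 ×ˢ Finset.range g2 ×ˢ Finset.range g3 with hI
  set φ : ℕ × ℕ × ℕ → ℕ := fun p =>
    g1 * g2 * g3 * s + g2 * g3 * A * p.1 + g3 * g1 * B * p.2.1 + g1 * g2 * C * p.2.2 with hφ
  have hset : {t : ℕ | numSol (g2 * g3 * A) (g3 * g1 * B) (g1 * g2 * C) t = k} = I.image φ := by
    ext t
    simp only [Set.mem_ofPred_eq, Finset.coe_image, Set.mem_image, Prod.exists, hI,
      Finset.mem_coe, Finset.mem_product, Finset.mem_range, hφ]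
    constructor
    · intro h
      have hne : {p : ℕ × ℕ × ℕ |
          g2 * g3 * A * p.1 + g3 * g1 * B * p.2.1 + g1 * g2 * C * p.2.2 = t}.Nonempty := by
        apply Set.nonempty_of_ncard_ne_zero
        unfold numSol at h
        omega
      obtain ⟨⟨x, y, z⟩, hxyz⟩ := hne
      simp only [Set.mem_ofPred_eq] at hxyz
      have ht : g1 * g2 * g3 * (A * (x / g1) + B * (y / g2) + C * (z / g3)) +
          g2 * g3 * A * (x % g1) + g3 * g1 * B * (y % g2) + g1 * g2 * C * (z % g3) = t := by
        rw [← hxyz]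
        conv_rhs => rw [← Nat.mod_add_div x g1, ← Nat.mod_add_div y g2, ← Nat.mod_add_div z g3]
        ring
      refine ⟨x % g1, y % g2, z % g3,
        ⟨Nat.mod_lt _ hg1, Nat.mod_lt _ hg2, Nat.mod_lt _ hg3⟩, ?_⟩
      rw [← ht, numSol_reduction g1 g2 g3 A B C hg1 hg2 hg3 h1 h2 h3 _ _ _ _ (Nat.mod_lt _ hg1)
        (Nat.mod_lt _ hg2) (Nat.mod_lt _ hg3), hs] at h
      rw [← ht, h]
    · rintro ⟨i1, i2, i3, ⟨hi1, hi2, hi3⟩, rfl⟩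
      rw [numSol_reduction g1 g2 g3 A B C hg1 hg2 hg3 h1 h2 h3 _ _ _ _ hi1 hi2 hi3, hs]
  have hinj : Set.InjOn φ I := by
    rintro ⟨x, y, z⟩ h ⟨x', y', z'⟩ h' heq
    simp only [hI, Finset.mem_coe, Finset.mem_product, Finset.mem_range] at h h'
    simp only [hφ] at heq
    have ex := modEq_of_linear_eq (a := g2 * g3 * A) (b := g3 * g1 * B) (c := g1 * g2 * C)
      (x := x) (y := y) (z := z) (x' := x') (y' := y') (z' := z') (g := g1) (u := 0) (v := 0)
      ⟨g3 * B, by ring⟩ ⟨g2 * C, by ring⟩ h1 (dvd_zero _) (dvd_zero _) (by linarith)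
    have ey := modEq_of_linear_eq (a := g3 * g1 * B) (b := g1 * g2 * C) (c := g2 * g3 * A)
      (x := y) (y := z) (z := x) (x' := y') (y' := z') (z' := x') (g := g2) (u := 0) (v := 0)
      ⟨g1 * C, by ring⟩ ⟨g3 * A, by ring⟩ h2 (dvd_zero _) (dvd_zero _) (by linarith)
    have ez := modEq_of_linear_eq (a := g1 * g2 * C) (b := g2 * g3 * A) (c := g3 * g1 * B)
      (x := z) (y := x) (z := y) (x' := z') (y' := x') (z' := y') (g := g3) (u := 0) (v := 0)
      ⟨g2 * A, by ring⟩ ⟨g1 * B, by ring⟩ h3 (dvd_zero _) (dvd_zero _) (by linarith)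
    rw [ex.eq_of_lt_of_lt h.1 h'.1, ey.eq_of_lt_of_lt h.2.1 h'.2.1,
      ez.eq_of_lt_of_lt h.2.2 h'.2.2]
  rw [hset, finsum_mem_coe_finset, Finset.sum_image hinj, hI, Finset.sum_product]
  refine Finset.sum_congr rfl fun i1 _ => ?_
  rw [Finset.sum_product]
  refine Finset.sum_congr rfl fun i2 _ => Finset.sum_congr rfl fun i3 _ => ?_
  simp only [hφ]
  push_cast
  ring

theorem stmt_13 (a b c : ℕ)
    (ha : 0 < a) (hb : 0 < b) (hc : 0 < c)
    (habc : Nat.gcd (Nat.gcd a b) c = 1)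
    (g1 g2 g3 : ℕ) (hg1 : g1 = Nat.gcd b c) (hg2 : g2 = Nat.gcd c a)
    (hg3 : g3 = Nat.gcd a b)
    (A B C : ℕ) (hA : A = a / (g2 * g3)) (hB : B = b / (g3 * g1))
    (hC : C = c / (g1 * g2))
    (α β : ℝ) (hα : α = ((A : ℝ) + B + C) / 2) (hβ : β = 2 * A * B * C)
    (M : ℤ) (hM : M = ⌊((2 * α * β - 1) ^ 2 - 4 * α ^ 2) / (4 * β) + α⌋ + 1)
    (k : ℕ)
    (γ δ : ℤ)
    (hγ : γ = ⌊Real.sqrt (β * ((k : ℝ) + α) + α ^ 2) - α⌋)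
    (hδ : δ = ⌊Real.sqrt (β * ((k : ℝ) - α) + α ^ 2) - α⌋)
    (hk : M ≤ (k : ℤ)) (hγδ : γ ≠ δ)
    (hsol : {p : ℕ × ℕ × ℕ |
      (A : ℤ) * p.1 + (B : ℤ) * p.2.1 + (C : ℤ) * p.2.2 = γ}.ncard = k) :
    ∑ᶠ t ∈ {t : ℕ | numSol a b c t = k}, (t : ℤ) =
      ∑ i1 ∈ Finset.range g1, ∑ i2 ∈ Finset.range g2, ∑ i3 ∈ Finset.range g3,
        ((g1 : ℤ) * g2 * g3 * γ + a * i1 + b * i2 + c * i3) := by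
  have hg1' : 0 < g1 := hg1 ▸ Nat.gcd_pos_of_pos_left _ hb
  have hg2' : 0 < g2 := hg2 ▸ Nat.gcd_pos_of_pos_left _ hc
  have hg3' : 0 < g3 := hg3 ▸ Nat.gcd_pos_of_pos_left _ ha
  have h1 : g1.Coprime a := by
    rw [hg1, Nat.coprime_comm, Nat.Coprime, ← Nat.gcd_assoc, habc]
  have h2 : g2.Coprime b := by
    rw [hg2, Nat.Coprime, Nat.gcd_assoc, Nat.gcd_comm, habc]
  have h3 : g3.Coprime c := by
    rw [hg3, Nat.Coprime, habc]
  have d1b : g1 ∣ b := hg1 ▸ Nat.gcd_dvd_left _ _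
  have d1c : g1 ∣ c := hg1 ▸ Nat.gcd_dvd_right _ _
  have d2c : g2 ∣ c := hg2 ▸ Nat.gcd_dvd_left _ _
  have d2a : g2 ∣ a := hg2 ▸ Nat.gcd_dvd_right _ _
  have d3a : g3 ∣ a := hg3 ▸ Nat.gcd_dvd_left _ _
  have d3b : g3 ∣ b := hg3 ▸ Nat.gcd_dvd_right _ _
  have haA : a = g2 * g3 * A := by
    rw [hA, Nat.mul_div_cancel' ((h2.coprime_dvd_right d3b).mul_dvd_of_dvd_of_dvd d2a d3a)]
  have hbB : b = g3 * g1 * B := by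
    rw [hB, Nat.mul_div_cancel' ((h3.coprime_dvd_right d1c).mul_dvd_of_dvd_of_dvd d3b d1b)]
  have hcC : c = g1 * g2 * C := by
    rw [hC, Nat.mul_div_cancel' ((h1.coprime_dvd_right d2a).mul_dvd_of_dvd_of_dvd d1c d2c)]
  clear hA hB hC
  have cop : ∀ g m n X Y : ℕ, 0 < g → Nat.gcd m n = g → g * X ∣ m → g * Y ∣ n → X.Coprime Y := by
    intro g m n X Y hg h hX hY
    have h4 : g * Nat.gcd X Y ∣ g * 1 := by
      rw [← Nat.gcd_mul_left, mul_one]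
      conv_rhs => rw [← h]
      exact Nat.gcd_dvd_gcd_of_dvd_left _ hX |>.trans (Nat.gcd_dvd_gcd_of_dvd_right _ hY)
    exact Nat.dvd_one.mp (Nat.dvd_of_mul_dvd_mul_left hg h4)
  have hAB : A.Coprime B :=
    cop g3 a b A B hg3' hg3.symm ⟨g2, by rw [haA]; ring⟩ ⟨g1, by rw [hbB]; ring⟩
  have hAC : A.Coprime C :=
    (cop g2 c a C A hg2' hg2.symm ⟨g1, by rw [hcC]; ring⟩ ⟨g3, by rw [haA]; ring⟩).symm
  have hBC : B.Coprime C :=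
    cop g1 b c B C hg1' hg1.symm ⟨g3, by rw [hbB]; ring⟩ ⟨g2, by rw [hcC]; ring⟩
  have hA0 : 0 < A := Nat.pos_of_ne_zero fun h => by simp [h] at haA; omega
  have hB0 : 0 < B := Nat.pos_of_ne_zero fun h => by simp [h] at hbB; omega
  have hC0 : 0 < C := Nat.pos_of_ne_zero fun h => by simp [h] at hcC; omega
  have hA1 : (1 : ℝ) ≤ A := by exact_mod_cast hA0
  have hB1 : (1 : ℝ) ≤ B := by exact_mod_cast hB0
  have hC1 : (1 : ℝ) ≤ C := by exact_mod_cast hC0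
  have hα0 : 0 < α := by rw [hα]; positivity
  have hβ2 : 2 ≤ β := by
    have h4 : (1 : ℝ) ≤ A * B * C := one_le_mul_of_one_le_of_one_le
      (one_le_mul_of_one_le_of_one_le hA1 hB1) hC1
    rw [hβ]
    linarith
  have hβ0 : 0 < β := by linarith
  have hkR : ((2 * α * β - 1) ^ 2 - 4 * α ^ 2) / (4 * β) + α < k := by
    have h4 := Int.lt_floor_add_one (((2 * α * β - 1) ^ 2 - 4 * α ^ 2) / (4 * β) + α)
    have h5 : (M : ℝ) ≤ k := by exact_mod_cast hk
    rw [hM] at h5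
    push_cast at h5
    linarith
  have hk0 : 0 < k := by
    have h4 : 0 < ((2 * α * β - 1) ^ 2 - 4 * α ^ 2) / (4 * β) + α := by
      rw [div_add' _ _ _ (by positivity)]
      apply div_pos _ (by positivity)
      have : α ^ 2 * 4 ≤ α ^ 2 * β ^ 2 := by
        apply mul_le_mul_of_nonneg_left _ (sq_nonneg α)
        nlinarith
      nlinarith [sq_nonneg α]
    exact_mod_cast h4.trans hkR
  have hγδ' : γ ≤ δ + 1 := by
    rw [hγ, hδ]
    exact floor_sqrt_le_floor_sqrt_add_one hβ0 hkR
  have hγ0 : 0 ≤ γ := by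
    obtain ⟨p, hp⟩ := Set.nonempty_of_ncard_ne_zero (hsol.trans_ne hk0.ne')
    rw [← show (A : ℤ) * p.1 + (B : ℤ) * p.2.1 + (C : ℤ) * p.2.2 = γ from hp]
    positivity
  have hbd : ∀ t, numSol A B C t = k → δ < t ∧ (t : ℤ) ≤ γ := by
    intro t ht
    have := floor_lt_and_le_floor A B C hA0 hB0 hC0 hAB hAC hBC α β hα hβ t
    rwa [ht, ← hγ, ← hδ] at this
  lift γ to ℕ using hγ0
  have hsγ : numSol A B C γ = k := by
    rw [← hsol]
    unfold numSol
    congr 1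
    ext p
    simp only [Set.mem_ofPred_eq]
    norm_cast
  have hs : ∀ t, numSol A B C t = k ↔ t = γ := by
    intro t
    refine ⟨fun h => ?_, fun h => h ▸ hsγ⟩
    have := hbd t h
    omega
  subst haA hbB hcC
  exact sum_numSol_eq g1 g2 g3 A B C hg1' hg2' hg3' h1 h2 h3 γ k hk0 hs
end

section
/- Let a = 191, b = 131, c = 117, n = 67529. There exists a triple (x̂,ŷ,ẑ) of nonnegative integers with a·x̂ + b·ŷ + c·ẑ = n such that for all s_1 ∈ Ŝ_1, s_2 ∈ Ŝ_2, s_3 ∈ Ŝ_3 (viewed as triples of integers), (x̂,ŷ,ẑ) ≠ s_1 − s_2 + s_3 (componentwise). In other words, the conjecture of He, Shiue and Venkat that every solution of ax + by + cz = n can be written as s_1 − s_2 + s_3 with s_i ∈ Ŝ_i is false. -/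
theorem stmt_18 :
    ∃ x y z : ℕ, 191 * x + 131 * y + 117 * z = 67529 ∧
      ∀ s1 s2 s3 : ℕ × ℕ × ℕ,
        (s1.1 = 0 ∧ 191 * s1.1 + 131 * s1.2.1 + 117 * s1.2.2 = 67529) →
        (s2.2.1 = 0 ∧ 191 * s2.1 + 131 * s2.2.1 + 117 * s2.2.2 = 67529) →
        (s3.2.2 = 0 ∧ 191 * s3.1 + 131 * s3.2.1 + 117 * s3.2.2 = 67529) →
        ¬ ((x : ℤ) = (s1.1 : ℤ) - s2.1 + s3.1 ∧
           (y : ℤ) = (s1.2.1 : ℤ) - s2.2.1 + s3.2.1 ∧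
           (z : ℤ) = (s1.2.2 : ℤ) - s2.2.2 + s3.2.2) := by
  refine ⟨1, 63, 505, by norm_num, ?_⟩
  rintro ⟨x₁, y₁, z₁⟩ ⟨x₂, y₂, z₂⟩ ⟨x₃, y₃, z₃⟩ ⟨h₁, -⟩ ⟨h₂, e₂⟩ ⟨h₃, e₃⟩ ⟨hx, -, -⟩
  dsimp only at h₁ h₂ h₃ e₂ e₃ hx
  have hx₂ : x₂ = 73 ∨ x₂ = 190 ∨ x₂ = 307 := by omega
  have hx₃ : x₃ = 36 ∨ x₃ = 167 ∨ x₃ = 298 := by omega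
  omega
end
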